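/- arXiv:1303.6341 — 2 statements merged into one kernel-verified Lean document; each statement's English description precedes it below -/
import Mathlib

section
/- Let k ≥ 1, let π₀ be a noncrossing matching of order k, let n ≥ k+1, and let b = (b_{k+2},…,b_n) be a sequence of integers with b_j ∈ {2j−2, 2j−1} for all k+2 ≤ j ≤ n. Let (Ψ_π)_{π∈NC_n} be a family of wheel polynomials of order n satisfying Ψ_π(σ) = 1 if σ = π and Ψ_π(σ) = 0 if σ ≠ π, for all σ ∈ NC_n, and for c ∈ NC_n^+ set Φ_c = Σ_{σ∈NC_n} C_{c,σ}·Ψ_σ. Then, as an identity of polynomials in ℂ[z_1,…,z_{2n}]: Σ_{π∈E_n(π₀,b)} Ψ_π = Σ_{a=(a_1,…,a_k)∈NC_k^+} C̃_{π₀,a} · Φ_{(1, 1+a_1, …, 1+a_k, b_{k+2}, …, b_n)}, where the sequence (1, 1+a_1, …, 1+a_k, b_{k+2}, …, b_n) belongs to NC_n^+. -/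
open scoped BigOperators

open MvPolynomial

attribute [local instance 10] Classical.propDecidable

/-- A noncrossing matching of order `n`, on the points `0, …, 2n-1`
(representing the 1-indexed points `1, …, 2n`): a fixed-point-free involution
with no crossing `a < b < c < d`, `f a = c`, `f b = d`. -/
structure NCM (n : ℕ) where
  f : Fin (2 * n) → Fin (2 * n)
  invol : ∀ k, f (f k) = k
  nofix : ∀ k, f k ≠ k
  noncross : ∀ a b c d : Fin (2 * n), a < b → b < c → c < d → f a = c → f b = d → False

theorem NCM.ext' {n : ℕ} {π σ : NCM n} (h : π.f = σ.f) : π = σ := by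
  cases π; cases σ; simpa using h

noncomputable instance {n : ℕ} : Fintype (NCM n) :=
  Fintype.ofInjective NCM.f fun _ _ h => NCM.ext' h

/-- `q = e^{2πi/3}`. -/
noncomputable def q : ℂ := Complex.exp (2 * Real.pi * Complex.I / 3)

/-- A wheel polynomial of order `n`: homogeneous of total degree `n(n-1)` and
vanishing under every substitution `z_j := q² z_i`, `z_k := q⁴ z_i` for `i < j < k`. -/
def IsWheel (n : ℕ) (p : MvPolynomial (Fin (2 * n)) ℂ) : Prop :=
  p.IsHomogeneous (n * (n - 1)) ∧
  ∀ i j k : Fin (2 * n), i < j → j < k →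
    (aeval fun l : Fin (2 * n) =>
      if l = j then C (q ^ 2) * X i
      else if l = k then C (q ^ 4) * X i
      else (X l : MvPolynomial (Fin (2 * n)) ℂ)) p = 0

/-- The `π`-evaluation `p(π) = p(q^{-π_1}, …, q^{-π_{2n}})`, where the `k`-th coordinate
is `q⁻¹` if `π` matches `k` to the right and `q` if it matches `k` to the left. -/
noncomputable def evalNC {n : ℕ} (p : MvPolynomial (Fin (2 * n)) ℂ) (π : NCM n) : ℂ :=
  eval (fun k => if k < π.f k then q⁻¹ else q) p

/-- Evaluation of a polynomial with all variables set to `1`. -/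
noncomputable def evalOne {n : ℕ} (p : MvPolynomial (Fin (2 * n)) ℂ) : ℂ :=
  eval (fun _ => (1 : ℂ)) p

/-- The alternating sign matrix numbers `ASM(n) = ∏_{j=0}^{n-1} (3j+1)!/(n+j)!`. -/
noncomputable def ASM (n : ℕ) : ℂ :=
  ∏ j ∈ Finset.range n, ((3 * j + 1).factorial : ℂ) / ((n + j).factorial : ℂ)

/-- Cyclic successor on `Fin m`. -/
def fsucc {m : ℕ} (k : Fin m) : Fin m := ⟨((k : ℕ) + 1) % m, Nat.mod_lt _ k.pos⟩

/-- The Temperley–Lieb operator `e_k` (underlying function on points): if `π` matches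
`k` with `k+1` it is `π`; otherwise it matches `k ↔ k+1`, `π(k) ↔ π(k+1)` and agrees
with `π` elsewhere (indices cyclic modulo `2n`). -/
def eRaw {n : ℕ} (k : Fin (2 * n)) (π : NCM n) : Fin (2 * n) → Fin (2 * n) :=
  if π.f k = fsucc k then π.f
  else fun m =>
    if m = k then fsucc k
    else if m = fsucc k then k
    else if m = π.f k then π.f (fsucc k)
    else if m = π.f (fsucc k) then π.f k
    else π.f m

/-- The stationarity linear system `2n·v_π = Σ_{k=1}^{2n} Σ_{π' : e_k(π') = π} v_{π'}`. -/
def Stationary {n : ℕ} (v : NCM n → ℂ) : Prop :=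
  ∀ π : NCM n, ((2 * n : ℕ) : ℂ) * v π =
    ∑ k : Fin (2 * n), ∑ π' : NCM n, if eRaw k π' = π.f then v π' else 0

/-- A fixed-point-free involution on `2n` points has exactly `n` "openers". -/
theorem card_openers {n : ℕ} (π : NCM n) :
    (Finset.univ.filter fun k => k < π.f k).card = n := by
  classical
  have hcard : (Finset.univ.filter fun k : Fin (2 * n) => k < π.f k).card
      = (Finset.univ.filter fun k : Fin (2 * n) => π.f k < k).card := by
    apply Finset.card_bij (fun a _ => π.f a)
    · intro a ha
      simp only [Finset.mem_filter, Finset.mem_univ, true_and] at ha ⊢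
      rw [π.invol]; exact ha
    · intro a ha b hb hab
      have h := congrArg π.f hab
      rwa [π.invol, π.invol] at h
    · intro b hb
      simp only [Finset.mem_filter, Finset.mem_univ, true_and] at hb
      refine ⟨π.f b, ?_, π.invol b⟩
      simp only [Finset.mem_filter, Finset.mem_univ, true_and]
      rw [π.invol]; exact hb
  have hdisj : Disjoint (Finset.univ.filter fun k : Fin (2 * n) => k < π.f k)
      (Finset.univ.filter fun k : Fin (2 * n) => π.f k < k) := by
    rw [Finset.disjoint_left]
    intro a haA haB
    simp only [Finset.mem_filter, Finset.mem_univ, true_and] at haA haB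
    exact absurd (haA.trans haB) (lt_irrefl a)
  have hunion : (Finset.univ.filter fun k : Fin (2 * n) => k < π.f k)
      ∪ (Finset.univ.filter fun k : Fin (2 * n) => π.f k < k) = Finset.univ := by
    ext a
    simp only [Finset.mem_union, Finset.mem_filter, Finset.mem_univ, true_and, iff_true]
    rcases lt_trichotomy a (π.f a) with h | h | h
    · exact Or.inl h
    · exact absurd h.symm (π.nofix a)
    · exact Or.inr h
  have hc := Finset.card_union_of_disjoint hdisj
  rw [hunion, Finset.card_univ, Fintype.card_fin] at hc
  omega

/-- `π⁺ : Fin n → ℕ`, the increasing enumeration (with 1-indexed values) of the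
set of points matched to the right by `π`. -/
noncomputable def plus {n : ℕ} (π : NCM n) : Fin n → ℕ := fun i =>
  ((((Finset.univ.filter fun k => k < π.f k).orderIsoOfFin (card_openers π) i :
      { x // x ∈ Finset.univ.filter fun k => k < π.f k }) : Fin (2 * n)) : ℕ) + 1

/-- `χ(m) = 0, 1, -1` according as `m ≡ 0, 1, 2 (mod 3)`. -/
def chi (m : ℤ) : ℤ := if m % 3 = 0 then 0 else if m % 3 = 1 then 1 else -1

/-- `p_{j,k}(a) = #{m : j ≤ a_m < k} − (k−j−1)/2` (arguments `j`, `k` 1-indexed). -/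
def pjkSeq {N : ℕ} (a : Fin N → ℕ) (j k : ℕ) : ℤ :=
  ((Finset.univ.filter fun m : Fin N => j ≤ a m ∧ a m < k).card : ℤ)
    - (((k - j - 1) / 2 : ℕ) : ℤ)

/-- `C_{a,σ} = ∏_{j<k matched by σ} χ(p_{j,k}(a))`. -/
noncomputable def CmatSeq {N n : ℕ} (a : Fin N → ℕ) (σ : NCM n) : ℤ :=
  ∏ j : Fin (2 * n), ∏ k : Fin (2 * n),
    if j < k ∧ σ.f j = k then chi (pjkSeq a ((j : ℕ) + 1) ((k : ℕ) + 1)) else 1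

/-- The matrix `(C_{π,σ})` over `ℂ`. -/
noncomputable def CmatC (k : ℕ) : Matrix (NCM k) (NCM k) ℂ :=
  Matrix.of fun π σ => ((CmatSeq (plus π) σ : ℤ) : ℂ)

/-- The matrix `C̃ = C⁻¹`. -/
noncomputable def Ctilde (k : ℕ) : Matrix (NCM k) (NCM k) ℂ := (CmatC k)⁻¹

/-- `π ∈ E_n(π₀)`: the matching `π` contains `π₀` as a submatching on the
(1-indexed) sites `2, …, 2k+1`. -/
def inE {k n : ℕ} (π₀ : NCM k) (π : NCM n) : Prop :=
  ∀ (j : Fin (2 * k)) (h : (j : ℕ) + 1 < 2 * n),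
    (π.f ⟨(j : ℕ) + 1, h⟩ : ℕ) = (π₀.f j : ℕ) + 1

/-- `π ∈ E_n(π₀, b)`: `π ∈ E_n(π₀)` and for `k+2 ≤ j ≤ n`, `π(2j-1) > 2j-1`
if and only if `b j = 2j-1` (1-indexed sites and values). -/
def inEb {k n : ℕ} (π₀ : NCM k) (b : ℕ → ℕ) (π : NCM n) : Prop :=
  inE π₀ π ∧ ∀ j : ℕ, k + 2 ≤ j → j ≤ n → ∀ h : 2 * j - 2 < 2 * n,
    (2 * j - 2 < (π.f ⟨2 * j - 2, h⟩ : ℕ) ↔ b j = 2 * j - 1)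

/-- The sequence `(1, 1+a_1, …, 1+a_k, b_{k+2}, …, b_n)` where `a = σ⁺`. -/
noncomputable def cseq (k n : ℕ) (b : ℕ → ℕ) (σ : NCM k) : Fin n → ℕ := fun i =>
  if h0 : (i : ℕ) = 0 then 1
  else if h1 : (i : ℕ) ≤ k then 1 + plus σ ⟨(i : ℕ) - 1, by omega⟩
  else b ((i : ℕ) + 1)

/-- Membership in `NC_n⁺`: strictly increasing sequences `1 ≤ a_1 < … < a_n ≤ 2n-1`
with `a_j ≤ 2j-1` for all `j` (1-indexed). -/
def IsNCPlus (n : ℕ) (a : Fin n → ℕ) : Prop :=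
  (∀ j, 1 ≤ a j) ∧ StrictMono a ∧ (∀ j : Fin n, a j ≤ 2 * (j : ℕ) + 1) ∧
    ∀ j, a j ≤ 2 * n - 1

/-- Number of terms of the sequence `a` at 0-indexed positions `< m`. -/
def Aseq {N : ℕ} (a : Fin N → ℕ) (m : ℕ) : ℕ :=
  (Finset.univ.filter fun i : Fin N => a i < m + 1).card

/-- Number of openers of `σ` at positions `< m`. -/
noncomputable def Ocnt {n : ℕ} (σ : NCM n) (m : ℕ) : ℕ :=
  (Finset.univ.filter fun j : Fin (2 * n) => (j : ℕ) < m ∧ j < σ.f j).card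

theorem pjk_eq {N : ℕ} (a : Fin N → ℕ) (j k : ℕ) (h : j ≤ k) :
    pjkSeq a (j + 1) (k + 1) = (Aseq a k : ℤ) - Aseq a j - (((k - j - 1) / 2 : ℕ) : ℤ) := by
  have h1 : Aseq a k = Aseq a j +
      (Finset.univ.filter fun m : Fin N => j + 1 ≤ a m ∧ a m < k + 1).card := by
    unfold Aseq
    simp only [Finset.card_filter]
    rw [← Finset.sum_add_distrib]
    apply Finset.sum_congr rfl
    intro i _
    split_ifs <;> omega
  unfold pjkSeq
  have h2 : k + 1 - (j + 1) - 1 = k - j - 1 := by omega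
  rw [h2]
  omega

theorem Aseq_mono {N : ℕ} (a : Fin N → ℕ) : Monotone (Aseq a) := by
  intro x y h
  apply Finset.card_le_card
  intro i hi
  simp only [Finset.mem_filter, Finset.mem_univ, true_and] at hi ⊢
  omega

theorem Aseq_of_iff {N : ℕ} (a : Fin N → ℕ) (m t : ℕ) (ht : t ≤ N)
    (h : ∀ i : Fin N, a i < m + 1 ↔ (i : ℕ) < t) : Aseq a m = t := by
  unfold Aseq
  simp only [h]
  rw [Fin.card_filter_val_lt]
  omega

theorem lt_Aseq_iff {N : ℕ} (a : Fin N → ℕ) (ha : StrictMono a) (m : ℕ) (i : Fin N) :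
    a i < m + 1 ↔ (i : ℕ) < Aseq a m := by
  constructor
  · intro h
    have : (Finset.univ.filter fun j : Fin N => (j : ℕ) < i + 1).card ≤ Aseq a m := by
      apply Finset.card_le_card
      intro j hj
      simp only [Finset.mem_filter, Finset.mem_univ, true_and] at hj ⊢
      have : a j ≤ a i := ha.monotone (by rw [Fin.le_def]; omega)
      omega
    rw [Fin.card_filter_val_lt] at this
    have := i.2
    omega
  · intro h
    by_contra hc
    have : Aseq a m ≤ (Finset.univ.filter fun j : Fin N => (j : ℕ) < i).card := by
      apply Finset.card_le_card
      intro j hj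
      simp only [Finset.mem_filter, Finset.mem_univ, true_and] at hj ⊢
      by_contra h2
      have : a i ≤ a j := ha.monotone (by rw [Fin.le_def]; omega)
      omega
    rw [Fin.card_filter_val_lt] at this
    have := i.2
    omega

theorem plus_strictMono {n : ℕ} (σ : NCM n) : StrictMono (plus σ) := by
  intro i j h
  unfold plus
  have := ((Finset.univ.filter fun k => k < σ.f k).orderIsoOfFin (card_openers σ)).strictMono h
  have h2 := Subtype.coe_lt_coe.mpr this
  rw [Fin.lt_def] at h2
  omega

theorem Aseq_plus {n : ℕ} (σ : NCM n) (m : ℕ) : Aseq (plus σ) m = Ocnt σ m := by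
  unfold Aseq Ocnt
  set e := (Finset.univ.filter fun k => k < σ.f k).orderIsoOfFin (card_openers σ) with he
  apply Finset.card_bij (fun i _ => (e i : Fin (2 * n)))
  · intro i hi
    simp only [Finset.mem_filter, Finset.mem_univ, true_and] at hi ⊢
    have h2 := (e i).2
    simp only [Finset.mem_filter, Finset.mem_univ, true_and] at h2
    refine ⟨?_, h2⟩
    unfold plus at hi
    rw [← he] at hi
    omega
  · intro i _ j _ hij
    exact e.injective (Subtype.ext hij)
  · intro j hj
    simp only [Finset.mem_filter, Finset.mem_univ, true_and] at hj
    refine ⟨e.symm ⟨j, by simp [hj.2]⟩, ?_, by simp⟩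
    simp only [Finset.mem_filter, Finset.mem_univ, true_and]
    unfold plus
    rw [← he]
    simp
    exact hj.1

theorem Ocnt_mono {n : ℕ} (σ : NCM n) : Monotone (Ocnt σ) := by
  intro x y h
  rw [← Aseq_plus, ← Aseq_plus]
  exact Aseq_mono _ h

theorem Ocnt_sub {n : ℕ} (σ : NCM n) (x y : ℕ) (h : x ≤ y) :
    Ocnt σ y = Ocnt σ x +
      (Finset.univ.filter fun j : Fin (2 * n) => (x ≤ (j : ℕ) ∧ (j : ℕ) < y) ∧ j < σ.f j).card := by
  unfold Ocnt
  simp only [Finset.card_filter]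
  rw [← Finset.sum_add_distrib]
  apply Finset.sum_congr rfl
  intro i _
  by_cases hi : i < σ.f i
  · simp only [hi, and_true]
    split_ifs <;> omega
  · simp [hi]

theorem Ocnt_succ {n : ℕ} (σ : NCM n) (x : ℕ) (hx : x < 2 * n) :
    Ocnt σ (x + 1) = Ocnt σ x + if x < (σ.f ⟨x, hx⟩ : ℕ) then 1 else 0 := by
  rw [Ocnt_sub σ x (x + 1) (by omega)]
  congr 1
  split_ifs with h
  · rw [Finset.card_eq_one]
    refine ⟨⟨x, hx⟩, ?_⟩
    ext j
    simp only [Finset.mem_filter, Finset.mem_univ, true_and, Finset.mem_singleton]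
    constructor
    · rintro ⟨h1, -⟩
      ext
      simp
      omega
    · rintro rfl
      exact ⟨⟨le_refl _, by simp⟩, h⟩
  · rw [Finset.card_eq_zero]
    ext j
    simp only [Finset.mem_filter, Finset.mem_univ, true_and, Finset.notMem_empty, iff_false]
    rintro ⟨h1, h2⟩
    have : j = ⟨x, hx⟩ := by ext; simp; omega
    subst this
    exact h h2

theorem card_interval (n x y : ℕ) (h : x ≤ y) (hy : y ≤ 2 * n) :
    (Finset.univ.filter fun j : Fin (2 * n) => x ≤ (j : ℕ) ∧ (j : ℕ) < y).card = y - x := by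
  have h1 := Fin.card_filter_val_lt (n := 2 * n) (m := y)
  have h2 := Fin.card_filter_val_lt (n := 2 * n) (m := x)
  have h3 : (Finset.univ.filter fun j : Fin (2 * n) => (j : ℕ) < y).card =
      (Finset.univ.filter fun j : Fin (2 * n) => (j : ℕ) < x).card +
      (Finset.univ.filter fun j : Fin (2 * n) => x ≤ (j : ℕ) ∧ (j : ℕ) < y).card := by
    simp only [Finset.card_filter]
    rw [← Finset.sum_add_distrib]
    apply Finset.sum_congr rfl
    intro i _
    split_ifs <;> omega
  omega

/-- If closers of an interval have their partner in the interval, it has at least as many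
openers as closers. -/
theorem half_le {n : ℕ} (σ : NCM n) (x y : ℕ) (h : x ≤ y) (hy : y ≤ 2 * n)
    (hc : ∀ j : Fin (2 * n), x ≤ (j : ℕ) → (j : ℕ) < y → x ≤ (σ.f j : ℕ)) :
    y - x ≤ 2 * (Ocnt σ y - Ocnt σ x) := by
  have h1 := Ocnt_sub σ x y h
  have h2 := card_interval n x y h hy
  have h3 : (Finset.univ.filter fun j : Fin (2 * n) => x ≤ (j : ℕ) ∧ (j : ℕ) < y).card =
     (Finset.univ.filter fun j : Fin (2 * n) => (x ≤ (j : ℕ) ∧ (j : ℕ) < y) ∧ j < σ.f j).card +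
     (Finset.univ.filter fun j : Fin (2 * n) => (x ≤ (j : ℕ) ∧ (j : ℕ) < y) ∧ ¬ j < σ.f j).card := by
    rw [← Finset.card_filter_add_card_filter_not (fun j : Fin (2 * n) => j < σ.f j),
      Finset.filter_filter, Finset.filter_filter]
  have h4 : (Finset.univ.filter fun j : Fin (2 * n) => (x ≤ (j : ℕ) ∧ (j : ℕ) < y) ∧ ¬ j < σ.f j).card
      ≤ (Finset.univ.filter fun j : Fin (2 * n) => (x ≤ (j : ℕ) ∧ (j : ℕ) < y) ∧ j < σ.f j).card := by
    apply Finset.card_le_card_of_injOn σ.f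
    · intro j hj
      simp only [Finset.coe_filter, Finset.mem_univ, true_and, Set.mem_ofPred_eq] at hj ⊢
      have h5 := σ.nofix j
      have h6 : σ.f j < j := lt_of_le_of_ne (not_lt.mp hj.2) h5
      rw [σ.invol]
      have := hc j hj.1.1 hj.1.2
      refine ⟨⟨this, ?_⟩, h6⟩
      rw [Fin.lt_def] at h6
      omega
    · intro a _ b _ hab
      have := congrArg σ.f hab
      rwa [σ.invol, σ.invol] at this
  omega

theorem le_half {n : ℕ} (σ : NCM n) (x y : ℕ) (h : x ≤ y) (hy : y ≤ 2 * n)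
    (hc : ∀ j : Fin (2 * n), x ≤ (j : ℕ) → (j : ℕ) < y → (σ.f j : ℕ) < y) :
    2 * (Ocnt σ y - Ocnt σ x) ≤ y - x := by
  have h1 := Ocnt_sub σ x y h
  have h2 := card_interval n x y h hy
  have h3 : (Finset.univ.filter fun j : Fin (2 * n) => x ≤ (j : ℕ) ∧ (j : ℕ) < y).card =
     (Finset.univ.filter fun j : Fin (2 * n) => (x ≤ (j : ℕ) ∧ (j : ℕ) < y) ∧ j < σ.f j).card +
     (Finset.univ.filter fun j : Fin (2 * n) => (x ≤ (j : ℕ) ∧ (j : ℕ) < y) ∧ ¬ j < σ.f j).card := by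
    rw [← Finset.card_filter_add_card_filter_not (fun j : Fin (2 * n) => j < σ.f j),
      Finset.filter_filter, Finset.filter_filter]
  have h4 : (Finset.univ.filter fun j : Fin (2 * n) => (x ≤ (j : ℕ) ∧ (j : ℕ) < y) ∧ j < σ.f j).card
      ≤ (Finset.univ.filter fun j : Fin (2 * n) => (x ≤ (j : ℕ) ∧ (j : ℕ) < y) ∧ ¬ j < σ.f j).card := by
    apply Finset.card_le_card_of_injOn σ.f
    · intro j hj
      simp only [Finset.coe_filter, Finset.mem_univ, true_and, Set.mem_ofPred_eq] at hj ⊢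
      have h6 := hj.2
      rw [σ.invol]
      have := hc j hj.1.1 hj.1.2
      refine ⟨⟨?_, this⟩, not_lt.mpr h6.le⟩
      rw [Fin.lt_def] at h6
      omega
    · intro a _ b _ hab
      have := congrArg σ.f hab
      rwa [σ.invol, σ.invol] at this
  omega

theorem half_eq {n : ℕ} (σ : NCM n) (x y : ℕ) (h : x ≤ y) (hy : y ≤ 2 * n)
    (hc : ∀ j : Fin (2 * n), x ≤ (j : ℕ) → (j : ℕ) < y → x ≤ (σ.f j : ℕ) ∧ (σ.f j : ℕ) < y) :
    2 * (Ocnt σ y - Ocnt σ x) = y - x :=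
  le_antisymm (le_half σ x y h hy fun j h1 h2 => (hc j h1 h2).2)
    (half_le σ x y h hy fun j h1 h2 => (hc j h1 h2).1)

theorem arc_interior {n : ℕ} (σ : NCM n) (j i : Fin (2 * n)) (h1 : j < i) (h2 : i < σ.f j) :
    j < σ.f i ∧ σ.f i < σ.f j := by
  constructor
  · by_contra hc
    have h3 : σ.f i ≠ j := by
      intro h
      rw [← h, σ.invol] at h2
      exact lt_irrefl _ h2
    exact σ.noncross (σ.f i) j i (σ.f j) (lt_of_le_of_ne (not_lt.mp hc) h3) h1 h2 (σ.invol i) rfl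
  · by_contra hc
    have h3 : σ.f j ≠ σ.f i := by
      intro h
      have := congrArg σ.f h
      rw [σ.invol, σ.invol] at this
      exact h1.ne this
    exact σ.noncross j i (σ.f j) (σ.f i) h1 h2 (lt_of_le_of_ne (not_lt.mp hc) h3) rfl rfl

/-- The interior of an arc is balanced. -/
theorem arc_half {n : ℕ} (σ : NCM n) (j : Fin (2 * n)) (h : j < σ.f j) :
    2 * (Ocnt σ (σ.f j) - Ocnt σ (j + 1)) = (σ.f j : ℕ) - (j + 1) := by
  rw [Fin.lt_def] at h
  apply half_eq
  · omega
  · exact (σ.f j).2.le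
  · intro i h1 h2
    have := arc_interior σ j i (by rw [Fin.lt_def]; omega) (by rw [Fin.lt_def]; omega)
    rw [Fin.lt_def, Fin.lt_def] at this
    omega

/-- Nonvanishing of all the `p`'s. -/
def NZ {n : ℕ} (A : ℕ → ℕ) (σ : NCM n) : Prop :=
  ∀ j : Fin (2 * n), j < σ.f j →
    (A (σ.f j) : ℤ) - A j - ((((σ.f j : ℕ) - j - 1) / 2 : ℕ) : ℤ) ≠ 0

theorem suffix_le {n : ℕ} (A : ℕ → ℕ) (hA : Monotone A) (σ : NCM n) (hz : NZ A σ) :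
    ∀ L x y : ℕ, y = x + L → y ≤ 2 * n →
    (∀ j : Fin (2 * n), x ≤ (j : ℕ) → (j : ℕ) < y → (σ.f j : ℕ) < y) →
    Ocnt σ y + A x ≤ A y + Ocnt σ x := by
  intro L
  induction L using Nat.strong_induction_on with
  | _ L ih =>
    intro x y hL hy hc
    rcases Nat.eq_zero_or_pos L with h0 | h0
    · subst h0
      have : y = x := by omega
      subst this
      omega
    · have hx : x < 2 * n := by omega
      have h1 := ih (L - 1) (by omega) (x + 1) y (by omega) hy
        (fun j h1 h2 => hc j (by omega) h2)
      have h2 := Ocnt_succ σ x hx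
      by_cases ho : x < (σ.f ⟨x, hx⟩ : ℕ)
      · rw [if_pos ho] at h2
        set k : ℕ := (σ.f ⟨x, hx⟩ : ℕ) with hk
        have hk2 : k < 2 * n := (σ.f ⟨x, hx⟩).2
        have hky : k < y := hc ⟨x, hx⟩ (le_refl _) (by simp; omega)
        have h3 := ih (y - (k + 1)) (by omega) (k + 1) y (by omega) hy
          (fun j h1 h2 => hc j (by omega) h2)
        have h4 := ih (k - (x + 1)) (by omega) (x + 1) k (by omega) (by omega) (by
          intro i h1 h2
          have := arc_interior σ ⟨x, hx⟩ i (by rw [Fin.lt_def]; simp; omega) (by rw [Fin.lt_def]; omega)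
          rw [Fin.lt_def, Fin.lt_def] at this
          omega)
        have h5 := Ocnt_succ σ k hk2
        have h6 : (σ.f ⟨k, hk2⟩ : ℕ) = x := by
          have : (⟨k, hk2⟩ : Fin (2 * n)) = σ.f ⟨x, hx⟩ := by ext; rfl
          rw [this, σ.invol]
        rw [h6, if_neg (by omega)] at h5
        have h7 := arc_half σ ⟨x, hx⟩ ho
        rw [← hk] at h7
        simp only at h7
        have h8 := hz ⟨x, hx⟩ ho
        rw [← hk] at h8
        simp only at h8
        have a1 := hA (show x ≤ x + 1 by omega)
        have a2 := hA (show k ≤ k + 1 by omega)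
        have a3 := Ocnt_mono σ (show x + 1 ≤ k by omega)
        omega
      · rw [if_neg ho] at h2
        have := hA (show x ≤ x + 1 by omega)
        omega

theorem arc_pos {n : ℕ} (A : ℕ → ℕ) (hA : Monotone A) (σ : NCM n) (hz : NZ A σ)
    (j : Fin (2 * n)) (h : j < σ.f j) : A j + ((σ.f j : ℕ) - j - 1) / 2 + 1 ≤ A (σ.f j) := by
  have h7 := arc_half σ j h
  have h8 := hz j h
  rw [Fin.lt_def] at h
  have h4 := suffix_le A hA σ hz ((σ.f j : ℕ) - (j + 1)) (j + 1) (σ.f j) (by omega)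
    (σ.f j).2.le (by
      intro i h1 h2
      have := arc_interior σ j i (by rw [Fin.lt_def]; omega) (by rw [Fin.lt_def]; omega)
      rw [Fin.lt_def, Fin.lt_def] at this
      omega)
  have a1 := hA (show (j : ℕ) ≤ j + 1 by omega)
  have a3 := Ocnt_mono σ (show (j : ℕ) + 1 ≤ σ.f j by omega)
  omega

theorem Cmat_prod {N n : ℕ} (a : Fin N → ℕ) (σ : NCM n) :
    CmatSeq a σ = ∏ j : Fin (2 * n), if j < σ.f j then
      chi ((Aseq a (σ.f j) : ℤ) - Aseq a j - ((((σ.f j : ℕ) - j - 1) / 2 : ℕ) : ℤ)) else 1 := by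
  unfold CmatSeq
  apply Finset.prod_congr rfl
  intro j _
  rw [Finset.prod_eq_single (σ.f j)]
  · simp only [and_true]
    split_ifs with h
    · rw [pjk_eq _ _ _ (le_of_lt h)]
    · rfl
  · intro k _ hk
    rw [if_neg]
    rintro ⟨-, h⟩
    exact hk h.symm
  · simp

theorem NZ_of_ne {N n : ℕ} (a : Fin N → ℕ) (σ : NCM n) (h : CmatSeq a σ ≠ 0) :
    NZ (Aseq a) σ := by
  rw [Cmat_prod, Finset.prod_ne_zero_iff] at h
  intro j hj h0
  have := h j (Finset.mem_univ _)
  rw [if_pos hj, h0] at this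
  exact this rfl

theorem Ocnt_total {n : ℕ} (σ : NCM n) : Ocnt σ (2 * n) = n := by
  have := half_eq σ 0 (2 * n) (by omega) le_rfl (fun j _ _ => ⟨by omega, (σ.f j).2⟩)
  have h0 : Ocnt σ 0 = 0 := by simp [Ocnt]
  omega

theorem Ocnt_zero {n : ℕ} (σ : NCM n) : Ocnt σ 0 = 0 := by simp [Ocnt]

theorem Ocnt_le_of_ne {n : ℕ} (π σ : NCM n) (h : CmatSeq (plus π) σ ≠ 0) (x : ℕ)
    (hx : x ≤ 2 * n) : Ocnt π x ≤ Ocnt σ x := by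
  have := suffix_le _ (Aseq_mono _) σ (NZ_of_ne _ σ h) (2 * n - x) x (2 * n) (by omega) le_rfl
    (fun j _ _ => (σ.f j).2)
  simp only [Aseq_plus, Ocnt_total] at this
  omega

theorem eq_of_Ocnt_aux {n : ℕ} (π σ : NCM n) (h : ∀ x ≤ 2 * n, Ocnt π x = Ocnt σ x)
    (j : Fin (2 * n)) (h1 : j < π.f j) : ¬ π.f j < σ.f j := by
  intro h2
  have h3 := arc_half π j h1
  have h4 := half_le σ (j + 1) (π.f j + 1) (by rw [Fin.lt_def] at h1; omega) (by omega) (by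
    intro i h5 h6
    have := arc_interior σ j i (by rw [Fin.lt_def]; omega) (by rw [Fin.lt_def] at *; omega)
    rw [Fin.lt_def, Fin.lt_def] at this
    omega)
  rw [← h _ (by omega), ← h _ (by omega)] at h4
  have h5 := Ocnt_succ π (π.f j) (π.f j).2
  simp only [Fin.eta, π.invol] at h5
  rw [Fin.lt_def] at h1
  rw [if_neg (by omega)] at h5
  omega

theorem eq_of_Ocnt {n : ℕ} (π σ : NCM n) (h : ∀ x ≤ 2 * n, Ocnt π x = Ocnt σ x) : π = σ := by
  have hop : ∀ j : Fin (2 * n), j < π.f j ↔ j < σ.f j := by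
    intro j
    have h1 := Ocnt_succ π j j.2
    have h2 := Ocnt_succ σ j j.2
    rw [h _ (by omega), h _ (by omega)] at h1
    rw [Fin.lt_def, Fin.lt_def]
    simp only [Fin.eta] at h1 h2
    split_ifs at h1 h2 <;> omega
  have key : ∀ j : Fin (2 * n), j < π.f j → π.f j = σ.f j := by
    intro j hj
    have a := eq_of_Ocnt_aux π σ h j hj
    have b := eq_of_Ocnt_aux σ π (fun x hx => (h x hx).symm) j ((hop j).1 hj)
    exact le_antisymm (not_lt.mp b) (not_lt.mp a)
  apply NCM.ext'
  funext j
  by_cases hj : j < π.f j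
  · exact key j hj
  · have h2 : π.f j < π.f (π.f j) := by
      rw [π.invol]
      exact lt_of_le_of_ne (not_lt.mp hj) (π.nofix j)
    have h3 := key _ h2
    rw [π.invol] at h3
    have h4 := congrArg σ.f h3
    rw [σ.invol] at h4
    exact h4.symm

theorem Cmat_diag {n : ℕ} (σ : NCM n) : CmatSeq (plus σ) σ = 1 := by
  rw [Cmat_prod]
  apply Finset.prod_eq_one
  intro j _
  split_ifs with h
  · have h1 := arc_half σ j h
    have h2 := Ocnt_succ σ j j.2
    simp only [Fin.eta] at h2
    rw [Fin.lt_def] at h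
    rw [if_pos h] at h2
    have a3 := Ocnt_mono σ (show (j : ℕ) + 1 ≤ σ.f j by omega)
    rw [Aseq_plus, Aseq_plus]
    have : (Ocnt σ (σ.f j) : ℤ) - Ocnt σ j - ((((σ.f j : ℕ) - j - 1) / 2 : ℕ) : ℤ) = 1 := by
      omega
    rw [this]
    rfl
  · rfl

theorem Cmat_det (k : ℕ) : IsUnit (CmatC k).det := by
  have hw : ∀ π σ : NCM k, CmatSeq (plus π) σ ≠ 0 →
      ∑ x ∈ Finset.range (2 * k + 1), Ocnt π x ≤ ∑ x ∈ Finset.range (2 * k + 1), Ocnt σ x := by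
    intro π σ h
    apply Finset.sum_le_sum
    intro x hx
    exact Ocnt_le_of_ne π σ h x (by simp at hx; omega)
  have hbt : (CmatC k).BlockTriangular
      (fun π => ∑ x ∈ Finset.range (2 * k + 1), Ocnt π x) := by
    intro π σ h
    by_contra hc
    have : CmatSeq (plus π) σ ≠ 0 := by
      intro h0
      apply hc
      simp [CmatC, h0]
    have := hw π σ this
    simp only at h
    omega
  rw [hbt.det, Finset.prod_eq_one]
  · exact isUnit_one
  · intro w _
    have : (CmatC k).toSquareBlock (fun π => ∑ x ∈ Finset.range (2 * k + 1), Ocnt π x) w = 1 := by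
      ext ⟨π, hπ⟩ ⟨σ, hσ⟩
      simp only [Matrix.toSquareBlock_def, Matrix.of_apply, Matrix.one_apply, Subtype.mk.injEq]
      split_ifs with h
      · subst h
        simp [CmatC, Cmat_diag]
      · by_contra hc
        have h1 : CmatSeq (plus π) σ ≠ 0 := by
          intro h0
          apply hc
          simp [CmatC, h0]
        apply h
        apply eq_of_Ocnt
        have h2 := (Finset.sum_eq_sum_iff_of_le (s := Finset.range (2 * k + 1))
          (f := Ocnt π) (g := Ocnt σ) (fun x hx =>
            Ocnt_le_of_ne π σ h1 x (by simp at hx; omega))).1 (hπ.trans hσ.symm)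
        intro x hx
        exact h2 x (by simp; omega)
    rw [this, Matrix.det_one]

theorem half_prefix {n : ℕ} (σ : NCM n) (m : ℕ) (hm : m ≤ 2 * n) : m ≤ 2 * Ocnt σ m := by
  have := half_le σ 0 m (by omega) hm (fun j _ _ => by omega)
  have := Ocnt_zero σ
  omega

theorem Ocnt_le {n : ℕ} (σ : NCM n) (m : ℕ) : Ocnt σ m ≤ n := by
  rw [← Aseq_plus]
  unfold Aseq
  exact (Finset.card_le_univ _).trans (by simp)

theorem plus_pos {n : ℕ} (σ : NCM n) (i : Fin n) : 1 ≤ plus σ i := by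
  unfold plus
  omega

theorem plus_le {n : ℕ} (σ : NCM n) (i : Fin n) : plus σ i ≤ 2 * i + 1 := by
  have h1 := lt_Aseq_iff (plus σ) (plus_strictMono σ) (2 * i + 1) i
  rw [Aseq_plus] at h1
  have h2 := half_prefix σ (2 * i + 1) (by omega)
  have := h1.2 (by omega)
  omega

theorem cseq_zero {k n : ℕ} {b : ℕ → ℕ} (σ : NCM k)
    (i : Fin n) (h : (i : ℕ) = 0) : cseq k n b σ i = 1 := by
  simp [cseq, h]

theorem cseq_mid {k n : ℕ} {b : ℕ → ℕ} (σ : NCM k)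
    (i : Fin n) (h : (i : ℕ) ≠ 0) (h2 : (i : ℕ) ≤ k) :
    cseq k n b σ i = 1 + plus σ ⟨(i : ℕ) - 1, by omega⟩ := by
  simp [cseq, h, h2]

theorem cseq_hi {k n : ℕ} {b : ℕ → ℕ}
    (hb : ∀ j : ℕ, k + 2 ≤ j → j ≤ n → b j = 2 * j - 2 ∨ b j = 2 * j - 1) (σ : NCM k)
    (i : Fin n) (h2 : k < (i : ℕ)) :
    cseq k n b σ i = b (i + 1) ∧ (b (i + 1) = 2 * i ∨ b (i + 1) = 2 * i + 1) := by
  constructor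
  · have : (i : ℕ) ≠ 0 := by omega
    simp [cseq, this, not_le.mpr h2]
  · have := hb (i + 1) (by omega) (by omega)
    omega

theorem cseq_NCPlus {k n : ℕ} {b : ℕ → ℕ}
    (hb : ∀ j : ℕ, k + 2 ≤ j → j ≤ n → b j = 2 * j - 2 ∨ b j = 2 * j - 1) (σ : NCM k)
    : IsNCPlus n (cseq k n b σ) := by
  have hpos : ∀ j, 1 ≤ cseq k n b σ j := by
    intro i
    by_cases h0 : (i : ℕ) = 0
    · rw [cseq_zero σ i h0]
    · by_cases h1 : (i : ℕ) ≤ k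
      · rw [cseq_mid σ i h0 h1]; omega
      · have := cseq_hi hb σ i (by omega)
        omega
  have hle : ∀ j : Fin n, cseq k n b σ j ≤ 2 * (j : ℕ) + 1 := by
    intro i
    by_cases h0 : (i : ℕ) = 0
    · rw [cseq_zero σ i h0]; omega
    · by_cases h1 : (i : ℕ) ≤ k
      · rw [cseq_mid σ i h0 h1]
        have := plus_le σ ⟨(i : ℕ) - 1, by omega⟩
        simp only at this
        omega
      · have := cseq_hi hb σ i (by omega)
        omega
  refine ⟨hpos, ?_, hle, ?_⟩
  · intro i j hij
    rw [Fin.lt_def] at hij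
    have hj0 : (j : ℕ) ≠ 0 := by omega
    by_cases hj : (j : ℕ) ≤ k
    · rw [cseq_mid σ j hj0 hj]
      by_cases h0 : (i : ℕ) = 0
      · rw [cseq_zero σ i h0]
        have := plus_pos σ ⟨(j : ℕ) - 1, by omega⟩
        omega
      · rw [cseq_mid σ i h0 (by omega)]
        have := plus_strictMono σ (show (⟨(i : ℕ) - 1, by omega⟩ : Fin k) < ⟨(j : ℕ) - 1, by omega⟩ by
          rw [Fin.lt_def]; simp only; omega)
        omega
    · have h1 := cseq_hi hb σ j (by omega)
      have h2 := hle i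
      omega
  · intro i
    have := hle i
    omega

theorem Ac_mid {k n : ℕ} (hn : k + 1 ≤ n) {b : ℕ → ℕ}
    (hb : ∀ j : ℕ, k + 2 ≤ j → j ≤ n → b j = 2 * j - 2 ∨ b j = 2 * j - 1) (σ : NCM k)
    (m : ℕ) (h1 : 1 ≤ m) (h2 : m ≤ 2 * k + 1) :
    Aseq (cseq k n b σ) m = 1 + Ocnt σ (m - 1) := by
  have hO := Ocnt_le σ (m - 1)
  apply Aseq_of_iff
  · omega
  · intro i
    by_cases h0 : (i : ℕ) = 0
    · rw [cseq_zero σ i h0]; omega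
    · by_cases h1 : (i : ℕ) ≤ k
      · rw [cseq_mid σ i h0 h1]
        have := lt_Aseq_iff (plus σ) (plus_strictMono σ) (m - 1) ⟨(i : ℕ) - 1, by omega⟩
        rw [Aseq_plus] at this
        simp only at this
        omega
      · have := cseq_hi hb σ i (by omega)
        omega

theorem Ac_odd {k n : ℕ} {b : ℕ → ℕ}
    (hb : ∀ j : ℕ, k + 2 ≤ j → j ≤ n → b j = 2 * j - 2 ∨ b j = 2 * j - 1) (σ : NCM k)
    (r : ℕ) (h1 : k ≤ r) (h2 : r < n) :
    Aseq (cseq k n b σ) (2 * r + 1) = r + 1 := by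
  apply Aseq_of_iff
  · omega
  · intro i
    have hle := (cseq_NCPlus hb σ).2.2.1 i
    by_cases h1 : (i : ℕ) ≤ k
    · omega
    · have := cseq_hi hb σ i (by omega)
      omega

theorem Ac_even {k n : ℕ} {b : ℕ → ℕ}
    (hb : ∀ j : ℕ, k + 2 ≤ j → j ≤ n → b j = 2 * j - 2 ∨ b j = 2 * j - 1) (σ : NCM k)
    (r : ℕ) (h1 : k < r) (h2 : r < n) :
    Aseq (cseq k n b σ) (2 * r) = if b (r + 1) = 2 * r + 1 then r else r + 1 := by
  apply Aseq_of_iff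
  · split_ifs <;> omega
  · intro i
    have hle := (cseq_NCPlus hb σ).2.2.1 i
    by_cases h1 : (i : ℕ) ≤ k
    · split_ifs <;> omega
    · have := cseq_hi hb σ i (by omega)
      by_cases hi : (i : ℕ) = r
      · rw [hi] at this
        split_ifs <;> omega
      · split_ifs <;> omega

/-- Parity of arcs. -/
theorem arc_parity {n : ℕ} (σ : NCM n) (j : Fin (2 * n)) (h : j < σ.f j) :
    ((σ.f j : ℕ) - (j + 1)) % 2 = 0 := by
  have := arc_half σ j h
  omega

theorem inner_closed {k n : ℕ} (hn : k + 1 ≤ n) {b : ℕ → ℕ}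
    (hb : ∀ j : ℕ, k + 2 ≤ j → j ≤ n → b j = 2 * j - 2 ∨ b j = 2 * j - 1) (σ : NCM k)
    (τ : NCM n) (hC : CmatSeq (cseq k n b σ) τ ≠ 0) (i : Fin (2 * n)) (h1 : 1 ≤ (i : ℕ))
    (h2 : (i : ℕ) ≤ 2 * k) : 1 ≤ (τ.f i : ℕ) ∧ (τ.f i : ℕ) ≤ 2 * k := by
  have hz := NZ_of_ne _ τ hC
  have hodd : ∀ j : Fin (2 * n), 1 ≤ (j : ℕ) → (j : ℕ) ≤ 2 * k → 2 * k < (τ.f j : ℕ) →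
      (j : ℕ) % 2 = 1 := by
    intro j a1 a2 a3
    by_contra hj
    have hlt : j < τ.f j := by rw [Fin.lt_def]; omega
    have b1 := arc_pos _ (Aseq_mono _) τ hz j hlt
    have b2 := arc_parity τ j hlt
    rw [Ac_mid hn hb σ j a1 (by omega)] at b1
    have b3 := half_prefix σ (j - 1) (by omega)
    have b4 : (τ.f j : ℕ) = 2 * ((τ.f j : ℕ) / 2) + 1 := by omega
    have b6 := (τ.f j).2
    have b5 := Ac_odd hb σ ((τ.f j : ℕ) / 2) (by omega) (by omega)
    rw [← b4] at b5
    omega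
  have hup : ∀ j : Fin (2 * n), 1 ≤ (j : ℕ) → (j : ℕ) ≤ 2 * k → (τ.f j : ℕ) ≤ 2 * k := by
    by_contra hcon
    push Not at hcon
    obtain ⟨j0, c1, c2, c3⟩ := hcon
    obtain ⟨j, hj, hmax⟩ := Finset.exists_max_image
      (Finset.univ.filter fun j : Fin (2 * n) => (1 ≤ (j : ℕ) ∧ (j : ℕ) ≤ 2 * k) ∧ 2 * k < (τ.f j : ℕ))
      (fun j => (j : ℕ)) ⟨j0, by simp; omega⟩
    simp only [Finset.mem_filter, Finset.mem_univ, true_and] at hj hmax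
    have d1 := hodd j hj.1.1 hj.1.2 hj.2
    have d2 := half_eq τ (j + 1) (2 * k + 1) (by omega) (by omega) (by
      intro i e1 e2
      have e3 := arc_interior τ j i (by rw [Fin.lt_def]; omega) (by rw [Fin.lt_def]; omega)
      rw [Fin.lt_def, Fin.lt_def] at e3
      refine ⟨by omega, ?_⟩
      by_contra e4
      have := hmax i ⟨⟨by omega, by omega⟩, by omega⟩
      omega)
    omega
  refine ⟨?_, hup i h1 h2⟩
  by_contra h0
  have hi0 : (τ.f i : ℕ) = 0 := by omega
  have d2 := half_eq τ 0 (2 * k + 1) (by omega) (by omega) (by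
    intro j e1 e2
    refine ⟨by omega, ?_⟩
    by_cases hj : (j : ℕ) = 0
    · have : j = τ.f i := by ext; omega
      rw [this, τ.invol]
      omega
    · have := hup j (by omega) (by omega)
      omega)
  omega

theorem exists_inner {k n : ℕ} (hn : k + 1 ≤ n) (τ : NCM n)
    (h : ∀ i : Fin (2 * n), 1 ≤ (i : ℕ) → (i : ℕ) ≤ 2 * k →
      1 ≤ (τ.f i : ℕ) ∧ (τ.f i : ℕ) ≤ 2 * k) : ∃ ρ : NCM k, inE ρ τ := by
  have hg : ∀ j : Fin (2 * k), (j : ℕ) + 1 < 2 * n := fun j => by omega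
  have hp : ∀ j : Fin (2 * k), 1 ≤ (τ.f ⟨j + 1, hg j⟩ : ℕ) ∧ (τ.f ⟨j + 1, hg j⟩ : ℕ) ≤ 2 * k :=
    fun j => h ⟨j + 1, hg j⟩ (by simp only; omega) (by simp only; omega)
  let f : Fin (2 * k) → Fin (2 * k) := fun j =>
    ⟨(τ.f ⟨j + 1, hg j⟩ : ℕ) - 1, by have := hp j; omega⟩
  have hf : ∀ j, (⟨(f j : ℕ) + 1, hg (f j)⟩ : Fin (2 * n)) = τ.f ⟨j + 1, hg j⟩ := by
    intro j
    ext
    simp only [f]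
    have := hp j
    omega
  refine ⟨⟨f, ?_, ?_, ?_⟩, ?_⟩
  · intro j
    have h1 := hf (f j)
    rw [hf j, τ.invol] at h1
    have := congrArg Fin.val h1
    simp only at this
    ext
    omega
  · intro j hj
    have h1 := hf j
    rw [hj] at h1
    exact τ.nofix _ h1.symm
  · intro a b c d h1 h2 h3 h4 h5
    rw [Fin.lt_def] at h1 h2 h3
    refine τ.noncross ⟨a + 1, hg a⟩ ⟨b + 1, hg b⟩ ⟨c + 1, hg c⟩ ⟨d + 1, hg d⟩ ?_ ?_ ?_ ?_ ?_
    · rw [Fin.lt_def]; simp only; omega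
    · rw [Fin.lt_def]; simp only; omega
    · rw [Fin.lt_def]; simp only; omega
    · rw [← hf]; simp only [h4]
    · rw [← hf]; simp only [h5]
  · intro j hj
    rw [← hf j]

/-- The condition on the odd sites. -/
def QQ {n : ℕ} (k : ℕ) (b : ℕ → ℕ) (π : NCM n) : Prop :=
  ∀ j : ℕ, k + 2 ≤ j → j ≤ n → ∀ h : 2 * j - 2 < 2 * n,
    (2 * j - 2 < (π.f ⟨2 * j - 2, h⟩ : ℕ) ↔ b j = 2 * j - 1)

theorem Cmat_inE {k n : ℕ} (hn : k + 1 ≤ n) {b : ℕ → ℕ}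
    (hb : ∀ j : ℕ, k + 2 ≤ j → j ≤ n → b j = 2 * j - 2 ∨ b j = 2 * j - 1) (σ ρ : NCM k)
    (τ : NCM n) (hE : inE ρ τ) :
    CmatSeq (cseq k n b σ) τ = if QQ k b τ then CmatSeq (plus σ) ρ else 0 := by
  have hin : ∀ i : Fin (2 * n), 1 ≤ (i : ℕ) → (i : ℕ) ≤ 2 * k →
      1 ≤ (τ.f i : ℕ) ∧ (τ.f i : ℕ) ≤ 2 * k := by
    intro i h1 h2
    have h3 := hE ⟨i - 1, by omega⟩ (by simp only; omega)
    have h4 : (⟨(i : ℕ) - 1 + 1, by omega⟩ : Fin (2 * n)) = i := by ext; simp only; omega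
    simp only [h4] at h3
    have := (ρ.f ⟨i - 1, by omega⟩).2
    omega
  have hout : ∀ i : Fin (2 * n), ¬ (1 ≤ (i : ℕ) ∧ (i : ℕ) ≤ 2 * k) →
      ¬ (1 ≤ (τ.f i : ℕ) ∧ (τ.f i : ℕ) ≤ 2 * k) := by
    intro i h1 h2
    have := hin _ h2.1 h2.2
    rw [τ.invol] at this
    exact h1 this
  have hc0 : Aseq (cseq k n b σ) 0 = 0 := by
    have h := (cseq_NCPlus hb σ).1
    simp only [Aseq, Finset.card_eq_zero]
    ext i
    have := h i
    simp
    omega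
  rw [Cmat_prod]
  rw [← Finset.prod_filter_mul_prod_filter_not Finset.univ
    (fun i : Fin (2 * n) => 1 ≤ (i : ℕ) ∧ (i : ℕ) ≤ 2 * k)]
  have hinner : (∏ j ∈ Finset.univ.filter (fun i : Fin (2 * n) => 1 ≤ (i : ℕ) ∧ (i : ℕ) ≤ 2 * k),
      if j < τ.f j then
      chi ((Aseq (cseq k n b σ) (τ.f j) : ℤ) - Aseq (cseq k n b σ) j
        - ((((τ.f j : ℕ) - j - 1) / 2 : ℕ) : ℤ)) else 1) = CmatSeq (plus σ) ρ := by
    rw [Cmat_prod]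
    symm
    apply Finset.prod_bij (fun (i : Fin (2 * k)) _ => (⟨i + 1, by omega⟩ : Fin (2 * n)))
    · intro i _
      simp only [Finset.mem_filter, Finset.mem_univ, true_and]
      omega
    · intro i _ j _ hij
      have := congrArg Fin.val hij
      simp only at this
      ext
      omega
    · intro j hj
      simp only [Finset.mem_filter, Finset.mem_univ, true_and] at hj
      refine ⟨⟨j - 1, by omega⟩, Finset.mem_univ _, ?_⟩
      ext
      simp only
      omega
    · intro i _
      have h1 := hE i (by omega)
      simp only [Fin.lt_def, h1]
      rw [Ac_mid hn hb σ _ (by omega) (by omega), Ac_mid hn hb σ _ (by omega) (by omega),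
        Aseq_plus, Aseq_plus]
      have e1 : (ρ.f i : ℕ) + 1 - (i + 1) - 1 = (ρ.f i : ℕ) - i - 1 := by omega
      simp only [e1, Nat.add_sub_cancel, Nat.add_lt_add_iff_right]
      congr 2
      push_cast
      ring
  rw [hinner]
  split_ifs with hQ
  · rw [Finset.prod_eq_one, mul_one]
    intro j hj
    simp only [Finset.mem_filter, Finset.mem_univ, true_and] at hj
    split_ifs with hlt
    · have hp := arc_parity τ j hlt
      have ho := hout j hj
      have hτ := (τ.f j).2
      rw [Fin.lt_def] at hlt
      have key : (Aseq (cseq k n b σ) (τ.f j) : ℤ) - Aseq (cseq k n b σ) j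
        - ((((τ.f j : ℕ) - j - 1) / 2 : ℕ) : ℤ) = 1 := by
        by_cases hj2 : (j : ℕ) % 2 = 0
        · have b4 : (τ.f j : ℕ) = 2 * ((τ.f j : ℕ) / 2) + 1 := by omega
          have b5 := Ac_odd hb σ ((τ.f j : ℕ) / 2) (by omega) (by omega)
          rw [← b4] at b5
          by_cases hj0 : (j : ℕ) = 0
          · rw [hj0, hc0, b5]
            omega
          · have c4 : (j : ℕ) = 2 * ((j : ℕ) / 2) := by omega
            have c5 := Ac_even hb σ ((j : ℕ) / 2) (by omega) (by omega)
            have c6 := hQ ((j : ℕ) / 2 + 1) (by omega) (by omega) (by omega)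
            have c7 : (⟨2 * ((j : ℕ) / 2 + 1) - 2, by omega⟩ : Fin (2 * n)) = j := by
              ext; simp only; omega
            simp only [c7] at c6
            rw [if_pos (by have := c6.1 (by omega); omega), ← c4] at c5
            omega
        · have b4 : (j : ℕ) = 2 * ((j : ℕ) / 2) + 1 := by omega
          have b5 := Ac_odd hb σ ((j : ℕ) / 2) (by omega) (by omega)
          rw [← b4] at b5
          have c4 : (τ.f j : ℕ) = 2 * ((τ.f j : ℕ) / 2) := by omega
          have c5 := Ac_even hb σ ((τ.f j : ℕ) / 2) (by omega) (by omega)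
          have c6 := hQ ((τ.f j : ℕ) / 2 + 1) (by omega) (by omega) (by omega)
          have c7 : (⟨2 * ((τ.f j : ℕ) / 2 + 1) - 2, by omega⟩ : Fin (2 * n)) = τ.f j := by
            ext; simp only; omega
          simp only [c7, τ.invol] at c6
          rw [if_neg (by intro h; have := c6.2 (by omega); omega), ← c4] at c5
          omega
      rw [key]
      rfl
    · rfl
  · unfold QQ at hQ
    push Not at hQ
    obtain ⟨J, h1, h2, h3, h4⟩ := hQ
    have he := Ac_even hb σ (J - 1) (by omega) (by omega)
    have hbJ := hb J h1 h2
    have g1 : J - 1 + 1 = J := by omega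
    have g2 : 2 * (J - 1) = 2 * J - 2 := by omega
    rw [g1, g2] at he
    set s : Fin (2 * n) := ⟨2 * J - 2, h3⟩ with hs
    have hsv : (s : ℕ) = 2 * J - 2 := rfl
    have ho := hout s (by omega)
    have hτ := (τ.f s).2
    by_cases hop : 2 * J - 2 < (τ.f s : ℕ)
    · have hne : b J ≠ 2 * J - 1 := by
        rcases h4 with h4 | h4
        · exact h4.2
        · omega
      rw [if_neg (by omega)] at he
      have hlt : s < τ.f s := hop
      have hp := arc_parity τ s hlt
      have b4 : (τ.f s : ℕ) = 2 * ((τ.f s : ℕ) / 2) + 1 := by omega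
      have b5 := Ac_odd hb σ ((τ.f s : ℕ) / 2) (by omega) (by omega)
      rw [← b4] at b5
      rw [Finset.prod_eq_zero (i := s), mul_zero]
      · simp only [Finset.mem_filter, Finset.mem_univ, true_and]
        omega
      · have key : (Aseq (cseq k n b σ) (τ.f s) : ℤ) - Aseq (cseq k n b σ) s
          - ((((τ.f s : ℕ) - s - 1) / 2 : ℕ) : ℤ) = 0 := by
          rw [hsv]
          omega
        rw [if_pos hlt, key]
        rfl
    · have hbe : b J = 2 * J - 1 := by
        rcases h4 with h4 | h4
        · omega
        · exact h4.2
      rw [if_pos (by omega)] at he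
      have hlt : τ.f s < τ.f (τ.f s) := by
        rw [τ.invol]
        exact lt_of_le_of_ne (by rw [Fin.le_def]; omega) (τ.nofix s)
      have hp := arc_parity τ _ hlt
      have hlt2 := hlt
      rw [τ.invol] at hp hlt2
      rw [Fin.lt_def] at hlt2
      have b4 : (τ.f s : ℕ) = 2 * ((τ.f s : ℕ) / 2) + 1 := by omega
      have b5 := Ac_odd hb σ ((τ.f s : ℕ) / 2) (by omega) (by omega)
      rw [← b4] at b5
      rw [Finset.prod_eq_zero (i := τ.f s), mul_zero]
      · simp only [Finset.mem_filter, Finset.mem_univ, true_and]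
        omega
      · rw [if_pos hlt, τ.invol]
        have key : (Aseq (cseq k n b σ) s : ℤ) - Aseq (cseq k n b σ) (τ.f s)
          - ((((s : ℕ) - τ.f s - 1) / 2 : ℕ) : ℤ) = 0 := by
          rw [hsv]
          omega
        rw [key]
        rfl

theorem Cmat_expand {k n : ℕ} (hn : k + 1 ≤ n) {b : ℕ → ℕ}
    (hb : ∀ j : ℕ, k + 2 ≤ j → j ≤ n → b j = 2 * j - 2 ∨ b j = 2 * j - 1) (σ : NCM k)
    (τ : NCM n) :
    ((CmatSeq (cseq k n b σ) τ : ℤ) : ℂ) =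
      ∑ ρ : NCM k, CmatC k σ ρ * if inEb ρ b τ then 1 else 0 := by
  by_cases hex : ∃ ρ : NCM k, inE ρ τ
  · obtain ⟨ρ, hρ⟩ := hex
    rw [Finset.sum_eq_single ρ]
    · rw [Cmat_inE hn hb σ ρ τ hρ]
      by_cases hQ : QQ k b τ
      · have : inEb ρ b τ := ⟨hρ, hQ⟩
        simp [hQ, this, CmatC]
      · have : ¬ inEb ρ b τ := fun h => hQ h.2
        simp [hQ, this]
    · intro ρ' _ hne
      rw [if_neg, mul_zero]
      rintro ⟨h, -⟩
      apply hne
      apply NCM.ext'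
      funext j
      have h1 := h j (by omega)
      have h2 := hρ j (by omega)
      ext
      omega
    · simp
  · have h0 : CmatSeq (cseq k n b σ) τ = 0 := by
      by_contra hc
      exact hex (exists_inner hn τ (inner_closed hn hb σ τ hc))
    rw [h0, Finset.sum_eq_zero]
    · simp
    · intro ρ _
      rw [if_neg, mul_zero]
      rintro ⟨h, -⟩
      exact hex ⟨ρ, h⟩

/-- Theorem 2.25: `Σ_{π ∈ E_n(π₀,b)} Ψ_π = Σ_{a ∈ NC_k⁺} C̃_{π₀,a}
Φ_{(1, 1+a_1, …, 1+a_k, b_{k+2}, …, b_n)}`, where `Φ_c = Σ_σ C_{c,σ} Ψ_σ`, and the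
displayed sequence belongs to `NC_n⁺`. -/
theorem submatching_event_expansion (k : ℕ) (hk : 1 ≤ k) (π₀ : NCM k)
    (n : ℕ) (hn : k + 1 ≤ n) (b : ℕ → ℕ)
    (hb : ∀ j : ℕ, k + 2 ≤ j → j ≤ n → b j = 2 * j - 2 ∨ b j = 2 * j - 1)
    (Ψ : NCM n → MvPolynomial (Fin (2 * n)) ℂ)
    (hwheel : ∀ π, IsWheel n (Ψ π))
    (hdual : ∀ π σ : NCM n, evalNC (Ψ π) σ = if σ = π then 1 else 0) :
    (∀ σ : NCM k, IsNCPlus n (cseq k n b σ)) ∧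
    (∑ π : NCM n, if inEb π₀ b π then Ψ π else 0) =
      ∑ σ : NCM k, Ctilde k π₀ σ •
        ∑ τ : NCM n, ((CmatSeq (cseq k n b σ) τ : ℤ) : ℂ) • Ψ τ := by
  refine ⟨fun σ => cseq_NCPlus hb σ, ?_⟩
  have hinv : Ctilde k * CmatC k = 1 := Matrix.nonsing_inv_mul _ (Cmat_det k)
  simp only [Finset.smul_sum, smul_smul]
  rw [Finset.sum_comm]
  apply Finset.sum_congr rfl
  intro τ _
  rw [← Finset.sum_smul]
  have key : ∑ σ : NCM k, Ctilde k π₀ σ * ((CmatSeq (cseq k n b σ) τ : ℤ) : ℂ) =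
      if inEb π₀ b τ then 1 else 0 := by
    simp only [Cmat_expand hn hb, Finset.mul_sum, ← mul_assoc]
    rw [Finset.sum_comm]
    simp only [← Finset.sum_mul, ← Matrix.mul_apply, hinv, Matrix.one_apply]
    rw [Finset.sum_eq_single π₀]
    · simp
    · intro x _ hx
      rw [if_neg (Ne.symm hx), zero_mul]
    · simp
  rw [key]
  split_ifs <;> simp
end

section
/- Let n ≥ 1 and let (Ψ_π)_{π∈NC_n} be a family of wheel polynomials of order n satisfying Ψ_π(σ) = 1 if σ = π and Ψ_π(σ) = 0 if σ ≠ π, for all σ ∈ NC_n. Then Σ_{π∈NC_n} Ψ_π(1,1,…,1) = ASM(n), where Ψ_π(1,1,…,1) denotes the evaluation of Ψ_π with all 2n variables set equal to 1. -/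
open scoped BigOperators

open MvPolynomial

attribute [local instance 10] Classical.propDecidable

section Tools

theorem q_cube : q ^ 3 = 1 := by
  unfold q
  rw [← Complex.exp_nat_mul]
  rw [show ((3 : ℕ) : ℂ) * (2 * Real.pi * Complex.I / 3) = 2 * Real.pi * Complex.I by
    push_cast; ring]
  exact Complex.exp_two_pi_mul_I

theorem q_ne_one : q ≠ 1 := by
  intro h
  unfold q at h
  rw [Complex.exp_eq_one_iff] at h
  obtain ⟨m, hm⟩ := h
  have h2 : (2 * Real.pi * Complex.I : ℂ) ≠ 0 := Complex.two_pi_I_ne_zero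
  have h3 : (3 * m : ℂ) = 1 := by
    have : (2 * Real.pi * Complex.I : ℂ) * (3 * m) = 2 * Real.pi * Complex.I * 1 := by
      linear_combination (-3) * hm
    exact mul_left_cancel₀ h2 this
  have h4 : (3 * m : ℤ) = 1 := by exact_mod_cast h3
  omega

theorem q_ne_zero : q ≠ 0 := Complex.exp_ne_zero _

theorem q_quad : 1 + q + q ^ 2 = 0 := by
  have h : (q - 1) * (1 + q + q ^ 2) = 0 := by linear_combination q_cube
  rcases mul_eq_zero.1 h with h | h
  · exact absurd (sub_eq_zero.1 h) q_ne_one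
  · exact h

theorem q_inv : q⁻¹ = q ^ 2 := by
  apply inv_eq_of_mul_eq_one_right
  linear_combination q_cube

theorem q_four : q ^ 4 = q := by linear_combination q * q_cube

theorem q_sq_ne_one : q ^ 2 ≠ 1 := by
  intro h
  apply q_ne_one
  linear_combination q_cube - q * h

theorem q_sq_ne_q : q ^ 2 ≠ q := by
  intro h
  apply q_ne_one
  linear_combination q ^ 2 * h - q * q_cube + q_cube

variable {ι : Type*}

theorem eval_bind (g : ι → MvPolynomial ι ℂ) (p : MvPolynomial ι ℂ) (z : ι → ℂ) :
    eval z (bind₁ g p) = eval (fun l => eval z (g l)) p := by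
  rw [← coe_aeval_eq_eval, ← coe_aeval_eq_eval]
  exact aeval_bind₁ z g p

theorem dens (g : ι → MvPolynomial ι ℂ) (L R : MvPolynomial ι ℂ)
    (h : ∀ z, eval (fun l => eval z (g l)) (L * R) = 0) (z0 : ι → ℂ)
    (h0 : eval (fun l => eval z0 (g l)) L ≠ 0) (z : ι → ℂ) :
    eval (fun l => eval z (g l)) R = 0 := by
  have h1 : bind₁ g L * bind₁ g R = 0 := by
    apply MvPolynomial.funext
    intro x
    rw [← map_mul, eval_bind, h, map_zero]
  rcases mul_eq_zero.1 h1 with h1 | h1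
  · exfalso; apply h0; rw [← eval_bind, h1, map_zero]
  · rw [← eval_bind, h1, map_zero]

theorem lin_dvd [DecidableEq ι] (k i : ι) (c : ℂ) (p : MvPolynomial ι ℂ)
    (h : ∀ z : ι → ℂ, z k = c * z i → eval z p = 0) (hki : k ≠ i) :
    (X k - C c * X i) ∣ p := by
  set g : ι → MvPolynomial ι ℂ := fun l => if l = k then C c * X i else X l with hg
  have h1 : bind₁ g p = 0 := by
    apply MvPolynomial.funext
    intro z
    rw [eval_bind, map_zero]
    apply h
    simp [hg, hki.symm]
  have h2 : (Ideal.Quotient.mkₐ ℂ (Ideal.span {(X k - C c * X i : MvPolynomial ι ℂ)})).comp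
      (bind₁ g) = Ideal.Quotient.mkₐ ℂ (Ideal.span {(X k - C c * X i : MvPolynomial ι ℂ)}) := by
    apply MvPolynomial.algHom_ext
    intro l
    simp only [AlgHom.comp_apply, bind₁_X_right, hg]
    split_ifs with hl
    · subst hl
      rw [Ideal.Quotient.mkₐ_eq_mk, Ideal.Quotient.mk_eq_mk_iff_sub_mem,
        Ideal.mem_span_singleton]
      exact ⟨-1, by ring⟩
    · rfl
  have h3 := DFunLike.congr_fun h2 p
  rw [AlgHom.comp_apply, h1, map_zero, eq_comm, Ideal.Quotient.mkₐ_eq_mk,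
    Ideal.Quotient.eq_zero_iff_mem, Ideal.mem_span_singleton] at h3
  exact h3

theorem lin_ne [DecidableEq ι] (k i : ι) (c : ℂ) (hki : k ≠ i) :
    (X k - C c * X i : MvPolynomial ι ℂ) ≠ 0 := by
  intro h
  have := congrArg (eval (fun l => if l = k then (1 : ℂ) else 0)) h
  simp [hki.symm] at this

theorem lin_deg [DecidableEq ι] (k i : ι) (c : ℂ) (hki : k ≠ i) :
    (X k - C c * X i : MvPolynomial ι ℂ).totalDegree = 1 := by
  apply IsHomogeneous.totalDegree _ (lin_ne k i c hki)
  apply IsHomogeneous.sub (isHomogeneous_X _ _)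
  simpa using (isHomogeneous_C ι c).mul (isHomogeneous_X ℂ i)

theorem prod_deg [DecidableEq ι] {τ : Type*} (T : Finset τ) (kk ii : τ → ι) (c : τ → ℂ)
    (hne : ∀ t ∈ T, kk t ≠ ii t) (r : MvPolynomial ι ℂ) (hr : r ≠ 0) :
    ((∏ t ∈ T, (X (kk t) - C (c t) * X (ii t))) * r).totalDegree = T.card + r.totalDegree := by
  classical
  induction T using Finset.induction_on with
  | empty => simp
  | insert a T ha ih =>
    rw [Finset.prod_insert ha, mul_assoc, totalDegree_mul_of_isDomain, lin_deg,
      ih (fun t ht => hne t (Finset.mem_insert_of_mem ht)), Finset.card_insert_of_notMem ha]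
    · ring
    · exact hne a (Finset.mem_insert_self _ _)
    · exact lin_ne _ _ _ (hne a (Finset.mem_insert_self _ _))
    · apply mul_ne_zero _ hr
      rw [Finset.prod_ne_zero_iff]
      intro t ht
      exact lin_ne _ _ _ (hne t (Finset.mem_insert_of_mem ht))

theorem prod_dvd [DecidableEq ι] {τ : Type*} (T : Finset τ) (kk ii : τ → ι) (c : τ → ℂ)
    (p : MvPolynomial ι ℂ)
    (hne : ∀ t ∈ T, kk t ≠ ii t)
    (hv : ∀ t ∈ T, ∀ z : ι → ℂ, z (kk t) = c t * z (ii t) → eval z p = 0)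
    (hd : ∀ t ∈ T, ∀ u ∈ T, t ≠ u → ∃ z : ι → ℂ, z (kk t) = c t * z (ii t) ∧
      z (kk u) ≠ c u * z (ii u)) :
    ∃ r, p = (∏ t ∈ T, (X (kk t) - C (c t) * X (ii t))) * r := by
  classical
  induction T using Finset.induction_on with
  | empty => exact ⟨p, by simp⟩
  | insert a T ha ih =>
    obtain ⟨r, hr⟩ := ih (fun t ht => hne t (Finset.mem_insert_of_mem ht))
      (fun t ht => hv t (Finset.mem_insert_of_mem ht))
      (fun t ht u hu => hd t (Finset.mem_insert_of_mem ht) u (Finset.mem_insert_of_mem hu))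
    have haa := Finset.mem_insert_self a T
    have key : ∀ z : ι → ℂ, z (kk a) = c a * z (ii a) → eval z r = 0 := by
      set g : ι → MvPolynomial ι ℂ := fun l => if l = kk a then C (c a) * X (ii a) else X l with hg
      have hg1 : ∀ z : ι → ℂ, (fun l => eval z (g l)) (kk a) = c a * (fun l => eval z (g l)) (ii a) := by
        intro z
        simp [hg, (hne a haa).symm]
      have hg2 : ∀ z : ι → ℂ, z (kk a) = c a * z (ii a) → (fun l => eval z (g l)) = z := by
        intro z hz
        funext l
        simp only [hg]
        split_ifs with hl
        · subst hl; simp [hz]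
        · simp
      have step : ∀ S : Finset τ, S ⊆ T → ∀ r', (∀ z : ι → ℂ, eval (fun l => eval z (g l))
          ((∏ t ∈ S, (X (kk t) - C (c t) * X (ii t))) * r') = 0) →
          ∀ z : ι → ℂ, eval (fun l => eval z (g l)) r' = 0 := by
        intro S
        induction S using Finset.induction_on with
        | empty => intro _ r' h; simpa using h
        | insert b S hb ih2 =>
          intro hS r' h
          obtain ⟨hbT, hST⟩ := Finset.insert_subset_iff.1 hS
          apply ih2 hST
          obtain ⟨z0, hz0, hz1⟩ := hd a haa b (Finset.mem_insert_of_mem hbT)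
            (by rintro rfl; exact ha hbT)
          apply dens g (X (kk b) - C (c b) * X (ii b))
          · intro z; have h' := h z
            rw [Finset.prod_insert hb, mul_assoc] at h'
            exact h'
          · rw [hg2 z0 hz0]
            simpa [sub_eq_zero] using hz1
      intro z hz
      rw [← hg2 z hz]
      apply step T (Finset.Subset.refl _)
      intro z
      rw [← hr]
      exact hv a haa _ (hg1 z)
    obtain ⟨r2, hr2⟩ := lin_dvd _ _ _ _ key (hne a haa)
    refine ⟨r2, ?_⟩
    rw [Finset.prod_insert ha, hr, hr2]; ring

theorem bind_deg (g : ι → MvPolynomial ι ℂ) (hg : ∀ i, (g i).totalDegree ≤ 1)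
    (p : MvPolynomial ι ℂ) : (bind₁ g p).totalDegree ≤ p.totalDegree := by
  conv_lhs => rw [p.as_sum, map_sum]
  apply totalDegree_finsetSum_le
  intro d hd
  rw [bind₁_monomial]
  refine (totalDegree_mul _ _).trans ?_
  rw [totalDegree_C, zero_add]
  refine (totalDegree_finsetProd _ _).trans ?_
  refine le_trans (Finset.sum_le_sum fun i _ => ?_) (le_totalDegree hd)
  refine (totalDegree_pow _ _).trans ?_
  exact (Nat.mul_le_mul_left _ (hg i)).trans (by simp)

/-- shift polynomial difference has lower degree. -/
theorem shift_low [DecidableEq ι] (i : ι) (a : ℂ) (D : ℕ) (p : MvPolynomial ι ℂ)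
    (hp : p.totalDegree ≤ D) :
    bind₁ (fun l => if l = i then X l + C a else X l) p - p = 0 ∨
    (bind₁ (fun l => if l = i then X l + C a else X l) p - p).totalDegree < D := by
  set g : ι → MvPolynomial ι ℂ := fun l => if l = i then X l + C a else X l with hg
  have hgd : ∀ l, (g l).totalDegree ≤ 1 := by
    intro l
    simp only [hg]
    split_ifs
    · refine (totalDegree_add _ _).trans ?_
      simp
    · simp
  have mono : ∀ (d : ι →₀ ℕ) (b : ℂ), (bind₁ g (monomial d b) - monomial d b = 0 ∨
      (bind₁ g (monomial d b) - monomial d b).totalDegree < (monomial d b).totalDegree) := by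
    intro d b
    refine induction_on_monomial (motive := fun p => bind₁ g p - p = 0 ∨
      (bind₁ g p - p).totalDegree < p.totalDegree) ?_ ?_ d b
    · intro a; left; simp
    · intro p l ih
      by_cases hp0 : p = 0
      · left; simp [hp0]
      have e1 : bind₁ g (p * X l) - p * X l = (bind₁ g p - p) * g l + p * (g l - X l) := by
        rw [map_mul, bind₁_X_right]; ring
      have e2 : (p * X l).totalDegree = p.totalDegree + 1 := by
        rw [totalDegree_mul_of_isDomain hp0 (X_ne_zero l), totalDegree_X]
      right
      rw [e1, e2, Nat.lt_succ_iff]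
      refine (totalDegree_add _ _).trans (max_le ?_ ?_)
      · rcases ih with ih | ih
        · simp [ih]
        · refine (totalDegree_mul _ _).trans ?_
          have := hgd l
          omega
      · refine (totalDegree_mul _ _).trans ?_
        have : (g l - X l).totalDegree = 0 := by
          simp only [hg]
          split_ifs <;> simp
        omega
  by_cases hz : D = 0
  · left
    subst hz
    rw [Nat.le_zero, totalDegree_eq_zero_iff_eq_C] at hp
    rw [hp]; simp
  · right
    have e : bind₁ g p - p = ∑ d ∈ p.support, (bind₁ g (monomial d (p.coeff d)) -
        monomial d (p.coeff d)) := by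
      rw [Finset.sum_sub_distrib, ← map_sum, ← p.as_sum]
    rw [e]
    apply Nat.lt_of_le_pred (Nat.pos_of_ne_zero hz)
    apply totalDegree_finsetSum_le
    intro d hd
    rcases mono d (p.coeff d) with h | h
    · rw [h]; simp
    · have h1 := totalDegree_monomial_le d (p.coeff d)
      have h2 := le_totalDegree hd
      have : (d.sum fun _ e => e) = d.degree := by rfl
      have : (monomial d (p.coeff d)).totalDegree ≤ D := by
        refine h1.trans (le_trans ?_ hp)
        exact h2
      apply Nat.le_pred_of_lt; omega

end Tools

section Uniq

variable {ι : Type*} [LinearOrder ι]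

/-- pointwise wheel condition on a finite set of indices -/
def Wh (s : Finset ι) (p : MvPolynomial ι ℂ) : Prop :=
  ∀ i ∈ s, ∀ j ∈ s, ∀ k ∈ s, i < j → j < k → ∀ z : ι → ℂ,
    z j = q ^ 2 * z i → z k = q ^ 4 * z i → eval z p = 0

/-- vanishing on `z_j = q² z_i` -/
def Van (i j : ι) (p : MvPolynomial ι ℂ) : Prop :=
  ∀ z : ι → ℂ, z j = q ^ 2 * z i → eval z p = 0

/-- indices of `s` strictly between -/
def inner_ (s : Finset ι) (i j : ι) : Finset ι := s.filter (fun k => i < k ∧ k < j)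

theorem card_pairs (s : Finset ι) :
    2 * ((s ×ˢ s).filter (fun t => t.1 < t.2)).card + s.card = s.card * s.card := by
  have h1 : ((s ×ˢ s).filter (fun t => t.1 < t.2)).card =
      ((s ×ˢ s).filter (fun t => t.2 < t.1)).card := by
    apply Finset.card_bij (fun t _ => (t.2, t.1))
    · intro t ht; simp at ht ⊢; tauto
    · rintro ⟨a, b⟩ _ ⟨c, d⟩ _ h; simp at h ⊢; tauto
    · rintro ⟨a, b⟩ h; exact ⟨(b, a), by simp at h ⊢; tauto, rfl⟩
  have h2 : ((s ×ˢ s).filter (fun t => t.1 = t.2)).card = s.card := by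
    symm
    apply Finset.card_bij (fun t _ => (t, t))
    · intro t ht; simpa using ht
    · intro a _ b _ h; simpa using h
    · rintro ⟨a, b⟩ h
      simp at h
      exact ⟨a, h.1.1, by simp [h.2]⟩
  have h3 := Finset.card_filter_add_card_filter_not (s := s ×ˢ s) (fun t => t.1 < t.2)
  have h4 := Finset.card_filter_add_card_filter_not
    (s := (s ×ˢ s).filter (fun t => ¬ t.1 < t.2)) (fun t => t.1 = t.2)
  rw [Finset.filter_filter, Finset.filter_filter] at h4
  have e1 : (s ×ˢ s).filter (fun t => ¬ t.1 < t.2 ∧ t.1 = t.2) =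
      (s ×ˢ s).filter (fun t => t.1 = t.2) := by
    apply Finset.filter_congr
    rintro ⟨a, b⟩ _
    simp only [not_lt]
    constructor
    · exact fun h => h.2
    · exact fun h => ⟨h.ge, h⟩
  have e2 : (s ×ˢ s).filter (fun t => ¬ t.1 < t.2 ∧ ¬ t.1 = t.2) =
      (s ×ˢ s).filter (fun t => t.2 < t.1) := by
    apply Finset.filter_congr
    rintro ⟨a, b⟩ _
    simp only [not_lt]
    constructor
    · exact fun h => lt_of_le_of_ne h.1 (Ne.symm h.2)
    · exact fun h => ⟨h.le, h.ne'⟩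
  rw [e1, e2] at h4
  rw [Finset.card_product] at h3
  omega

theorem all_van (n : ℕ) (s : Finset ι) (hs : s.card = 2 * (n + 1)) (p : MvPolynomial ι ℂ)
    (hd : p.totalDegree ≤ (n + 1) * n) (h : ∀ i ∈ s, ∀ j ∈ s, i < j → Van i j p) : p = 0 := by
  by_contra hp
  set T := (s ×ˢ s).filter (fun t => t.1 < t.2) with hT
  have hmem : ∀ t ∈ T, t.1 ∈ s ∧ t.2 ∈ s ∧ t.1 < t.2 := by
    intro t ht; simp [hT] at ht; tauto
  obtain ⟨r, hr⟩ := prod_dvd T (fun t => t.2) (fun t => t.1) (fun _ => q ^ 2) p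
    (fun t ht => (hmem t ht).2.2.ne')
    (fun t ht z hz => h t.1 (hmem t ht).1 t.2 (hmem t ht).2.1 (hmem t ht).2.2 z hz)
    (by
      rintro ⟨a, b⟩ ht ⟨c, d⟩ hu hne
      have h1 := (hmem _ ht).2.2
      have h2 := (hmem _ hu).2.2
      simp only at h1 h2 ⊢
      have hq := q_ne_zero
      by_cases hca : c = a
      · subst hca
        have hbd : d ≠ b := by rintro rfl; exact hne rfl
        refine ⟨fun l => if l = c then 1 else if l = b then q ^ 2 else 0, ?_, ?_⟩
        · simp [h1.ne']
        · simp [h2.ne', hbd, (pow_ne_zero 2 hq).symm]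
      · by_cases hcb : c = b
        · subst hcb
          refine ⟨fun l => if l = a then 1 else if l = c then q ^ 2 else 0, ?_, ?_⟩
          · simp [h1.ne']
          · have : d ≠ a := (h1.trans h2).ne'
            simp [h2.ne', hca, this, hq]
        · refine ⟨fun l => if l = c then 1 else 0, ?_, ?_⟩
          · simp [Ne.symm hca, Ne.symm hcb]
          · simp [h2.ne', (pow_ne_zero 2 hq).symm])
  have hr0 : r ≠ 0 := by rintro rfl; apply hp; rw [hr, mul_zero]
  have e := prod_deg T (fun t => t.2) (fun t => t.1) (fun _ => q ^ 2)
    (fun t ht => (hmem t ht).2.2.ne') r hr0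
  rw [← hr] at e
  have hc := card_pairs s
  rw [hs] at hc
  change 2 * T.card + _ = _ at hc
  nlinarith

/-- Main reduction: factor `p` on `z_j = q² z_i`. -/
theorem arch_red (n : ℕ) (s : Finset ι) (hs : s.card = 2 * (n + 1)) (p : MvPolynomial ι ℂ)
    (hw : Wh s p) (i j : ι) (hi : i ∈ s) (hj : j ∈ s) (hij : i < j)
    (hb : ∀ k ∈ inner_ s i j, Van i k p ∧ Van k j p) :
    ∃ R : MvPolynomial ι ℂ, Wh ((s.erase i).erase j) R ∧
      (R ≠ 0 → R.totalDegree + 2 * n + (inner_ s i j).card ≤ p.totalDegree) ∧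
      (∀ z : ι → ℂ, z j = q ^ 2 * z i → eval z R = 0 → eval z p = 0) ∧
      (inner_ s i j = ∅ → ∀ z : ι → ℂ, z j = q ^ 2 * z i → eval z p = 0 →
        (∀ k ∈ (s.erase i).erase j, z k ≠ q * z i) → eval z R = 0) := by
  set s' := (s.erase i).erase j with hs'
  have hq := q_ne_zero
  have hq3 := q_cube
  have hms : ∀ k ∈ s', k ∈ s ∧ k ≠ i ∧ k ≠ j := by
    intro k hk; simp [hs'] at hk; tauto
  have hcard : s'.card = 2 * n := by
    rw [hs', Finset.card_erase_of_mem, Finset.card_erase_of_mem hi, hs]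
    · omega
    · simp [hij.ne', hj]
  have hmb : ∀ k ∈ inner_ s i j, k ∈ s' ∧ i < k ∧ k < j := by
    intro k hk
    simp only [inner_, Finset.mem_filter] at hk
    refine ⟨?_, hk.2⟩
    simp [hs', hk.1, hk.2.1.ne', hk.2.2.ne]
  set g0 : ι → MvPolynomial ι ℂ := fun l => if l = j then C (q ^ 2) * X i else X l with hg0
  set F := bind₁ g0 p with hF
  have hFe : ∀ z : ι → ℂ, eval z F = eval (fun l => if l = j then q ^ 2 * z i else z l) p := by
    intro z
    rw [hF, eval_bind]
    congr 2
    funext l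
    simp only [hg0]
    split_ifs <;> simp
  have hFd : F.totalDegree ≤ p.totalDegree := by
    apply bind_deg
    intro l
    simp only [hg0]
    split_ifs
    · refine (totalDegree_mul _ _).trans ?_
      rw [totalDegree_C, totalDegree_X]
    · simp
  set T : Finset (ι × Bool) := s' ×ˢ {true} ∪ (inner_ s i j) ×ˢ {false} with hT
  have hTm : ∀ t : ι × Bool, t ∈ T ↔ (t.1 ∈ s' ∧ t.2 = true) ∨ (t.1 ∈ inner_ s i j ∧ t.2 = false) := by
    rintro ⟨a, b⟩; cases b <;> simp [hT]
  have hTc : T.card = 2 * n + (inner_ s i j).card := by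
    rw [hT, Finset.card_union_of_disjoint]
    · simp [hcard]
    · rw [Finset.disjoint_left]
      rintro ⟨a, b⟩ h1 h2
      simp at h1 h2
      rw [h1.2] at h2; exact absurd h2.2 (by simp)
  set c : ι × Bool → ℂ := fun t => if t.2 = true then (if t.1 ∈ inner_ s i j then q ^ 2 else q) else 1
    with hc
  have hc0 : ∀ t, c t ≠ 0 := by
    intro t; simp only [hc]; split_ifs <;> simp [hq]
  have hTs : ∀ t ∈ T, t.1 ∈ s' := by
    intro t ht
    rcases (hTm t).1 ht with h | h
    · exact h.1
    · exact (hmb _ h.1).1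
  have hTi : ∀ t ∈ T, t.1 ≠ i := fun t ht => (hms _ (hTs t ht)).2.1
  obtain ⟨R, hR⟩ := prod_dvd T (fun t => t.1) (fun _ => i) c F hTi
    (by
      intro t ht z hz
      rw [hFe]
      obtain ⟨hts, hti, htj⟩ := hms _ (hTs t ht)
      rcases (hTm t).1 ht with h | h
      · by_cases hbt : t.1 ∈ inner_ s i j
        · simp only [hc, h.2, hbt, if_true] at hz
          apply (hb _ hbt).1
          simp [htj, hij.ne, hz]
        · simp only [hc, h.2, hbt, if_true, if_false] at hz
          simp only [inner_, Finset.mem_filter, not_and, not_lt] at hbt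
          rcases lt_or_gt_of_ne hti with hlt | hgt
          · apply hw _ hts _ hi _ hj hlt hij
            · simp only [htj, hij.ne, if_false, hz]; linear_combination (-z i) * hq3
            · simp only [htj, if_true, if_false, hz]
              linear_combination (-q ^ 2 * z i) * hq3
          · have hjt : j < t.1 := lt_of_le_of_ne (hbt hts hgt) htj.symm
            apply hw _ hi _ hj _ hts hij hjt
            · simp [hij.ne]
            · simp only [htj, hij.ne, if_false, hz]; rw [q_four]
      · simp only [hc, h.2] at hz
        apply (hb _ h.1).2
        simp at hz
        simp [htj, hz])
    (by
      intro t ht u hu htu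
      by_cases h1 : t.1 = u.1
      · refine ⟨fun l => if l = i then 1 else if l = t.1 then c t else 0, ?_, ?_⟩
        · simp [hTi t ht]
        · simp only [← h1, hTi t ht, if_true, if_false, mul_one]
          have h2 : t.2 ≠ u.2 := fun h2 => htu (Prod.ext h1 h2)
          rcases (hTm t).1 ht with h3 | h3 <;> rcases (hTm u).1 hu with h4 | h4
          · rw [h3.2, h4.2] at h2; exact absurd rfl h2
          · rw [← h1] at h4
            simpa [hc, h3.2, h4.2, h4.1] using q_sq_ne_one
          · simp only [hc, h3.2, h4.2, ← h1, h3.1]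
            simpa using q_sq_ne_one.symm
          · rw [h3.2, h4.2] at h2; exact absurd rfl h2
      · refine ⟨fun l => if l = i then 1 else if l = t.1 then c t else 0, ?_, ?_⟩
        · simp [hTi t ht]
        · simp [hTi u hu, Ne.symm h1, (hc0 u).symm])
  have hPe : ∀ z : ι → ℂ, eval z (∏ t ∈ T, (X t.1 - C (c t) * X i)) =
      ∏ t ∈ T, (z t.1 - c t * z i) := by
    intro z; simp [map_prod]
  refine ⟨R, ?_, ?_, ?_, ?_⟩
  · intro a ha b hb' e he hab hbe z hzb hze
    set g : ι → MvPolynomial ι ℂ := fun l => if l = b then C (q ^ 2) * X a else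
      if l = e then C (q ^ 4) * X a else X l with hg
    have hg1 : ∀ z : ι → ℂ, (fun l => eval z (g l)) =
        fun l => if l = b then q ^ 2 * z a else if l = e then q ^ 4 * z a else z l := by
      intro z
      funext l
      simp only [hg]
      split_ifs <;> simp
    have hz : (fun l => eval z (g l)) = z := by
      rw [hg1]
      funext l
      split_ifs with h1 h2
      · rw [h1, hzb]
      · rw [h2, hze]
      · rfl
    rw [← hz]
    obtain ⟨has, hai, haj⟩ := hms _ ha
    obtain ⟨hbs, hbi, hbj⟩ := hms _ hb'
    obtain ⟨hes, hei, hej⟩ := hms _ he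
    apply dens g (∏ t ∈ T, (X t.1 - C (c t) * X i))
    · intro w
      rw [← hR, hFe]
      apply hw a has b hbs e hes hab hbe
      · have h1 := fun l => congrFun (hg1 w) l
        simp [h1, hbj, haj, hab.ne, (hab.trans hbe).ne]
      · have h1 := fun l => congrFun (hg1 w) l
        simp [h1, hej, haj, hab.ne, (hab.trans hbe).ne, hbe.ne']
    · show eval (fun l => eval (fun l => if l = i then 1 else 0) (g l)) _ ≠ 0
      rw [hg1, hPe, Finset.prod_ne_zero_iff]
      intro t ht
      simp only [hai, if_false, mul_zero, hbi.symm, hei.symm, if_true, hTi t ht]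
      simp [hc0]
  · intro hR0
    have e := prod_deg T (fun t => t.1) (fun _ => i) c hTi R hR0
    rw [← hR] at e
    omega
  · intro z hz hRz
    have : (fun l => if l = j then q ^ 2 * z i else z l) = z := by
      funext l
      split_ifs with h
      · rw [h, hz]
      · rfl
    rw [← this, ← hFe, hR, map_mul, hRz, mul_zero]
  · intro hbe z hz hpz hk
    have : (fun l => if l = j then q ^ 2 * z i else z l) = z := by
      funext l
      split_ifs with h
      · rw [h, hz]
      · rfl
    rw [← this, ← hFe, hR, map_mul, hPe, mul_eq_zero] at hpz
    rcases hpz with h | h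
    · exfalso
      rw [Finset.prod_eq_zero_iff] at h
      obtain ⟨t, ht, h⟩ := h
      apply hk t.1 (hTs t ht)
      rcases (hTm t).1 ht with h3 | h3
      · simp only [hc, h3.2, hbe, if_true] at h
        simpa using sub_eq_zero.1 h
      · rw [hbe] at h3; simp at h3
    · exact h

theorem inner_card_lt (s : Finset ι) (i j k : ι) (hk : k ∈ inner_ s i j) :
    (inner_ s i k).card < (inner_ s i j).card ∧ (inner_ s k j).card < (inner_ s i j).card := by
  have hk' := hk
  simp only [inner_, Finset.mem_filter] at hk'
  constructor
  · apply Finset.card_lt_card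
    rw [Finset.ssubset_iff_of_subset]
    · exact ⟨k, hk, by simp [inner_]⟩
    · intro l hl
      simp only [inner_, Finset.mem_filter] at hl ⊢
      exact ⟨hl.1, hl.2.1, hl.2.2.trans hk'.2.2⟩
  · apply Finset.card_lt_card
    rw [Finset.ssubset_iff_of_subset]
    · exact ⟨k, hk, by simp [inner_]⟩
    · intro l hl
      simp only [inner_, Finset.mem_filter] at hl ⊢
      exact ⟨hl.1, hk'.2.1.trans hl.2.1, hl.2.2⟩

theorem low_deg (n : ℕ) : ∀ (s : Finset ι), s.card = 2 * n → ∀ p : MvPolynomial ι ℂ,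
    p.totalDegree < n * (n - 1) → Wh s p → p = 0 := by
  induction n with
  | zero => intro s _ p hp; simp at hp
  | succ n ih =>
    intro s hs p hp hw
    rw [Nat.add_sub_cancel] at hp
    apply all_van n s hs p hp.le
    have main : ∀ m : ℕ, ∀ i ∈ s, ∀ j ∈ s, i < j → (inner_ s i j).card = m → Van i j p := by
      intro m
      induction m using Nat.strong_induction_on with
      | _ m ihm =>
        intro i hi j hj hij hm
        obtain ⟨R, hRw, hRd, hRz, _⟩ := arch_red n s hs p hw i j hi hj hij (by
          intro k hk
          have hlt := inner_card_lt s i j k hk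
          have hk' := hk
          simp only [inner_, Finset.mem_filter] at hk'
          exact ⟨ihm _ (hm ▸ hlt.1) i hi k hk'.1 hk'.2.1 rfl,
            ihm _ (hm ▸ hlt.2) k hk'.1 j hj hk'.2.2 rfl⟩)
        have hR : R = 0 := by
          by_contra hR0
          have h1 := hRd hR0
          apply hR0
          apply ih ((s.erase i).erase j) _ R _ hRw
          · rw [Finset.card_erase_of_mem, Finset.card_erase_of_mem hi, hs]
            · omega
            · simp [hij.ne', hj]
          · rcases n with _ | n
            · simp at hp
            · rw [Nat.add_sub_cancel]; nlinarith
        intro z hz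
        exact hRz z hz (by rw [hR, map_zero])
    intro i hi j hj hij
    exact main _ i hi j hj hij rfl

theorem indep (n : ℕ) (s : Finset ι) (hs : s.card = 2 * n) (p : MvPolynomial ι ℂ)
    (hp : p.totalDegree ≤ n * (n - 1)) (hw : Wh s p) (i : ι) (hi : i ∉ s) (z : ι → ℂ) (b : ℂ) :
    eval (Function.update z i b) p = eval z p := by
  set g : ι → MvPolynomial ι ℂ := fun l => if l = i then X l + C (b - z i) else X l with hg
  have hge : ∀ w : ι → ℂ, eval w (bind₁ g p) =
      eval (Function.update w i (w i + (b - z i))) p := by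
    intro w
    rw [eval_bind]
    congr 2
    funext l
    simp only [hg, Function.update_apply]
    split_ifs with h
    · subst h; simp
    · simp
  have hG : bind₁ g p - p = 0 := by
    rcases shift_low i (b - z i) _ p hp with h | h
    · exact h
    · apply low_deg n s hs _ h
      intro a ha c hc d hd hac hcd w h1 h2
      rw [map_sub]
      change eval w (bind₁ g p) - _ = 0
      rw [hge, hw a ha c hc d hd hac hcd w h1 h2, sub_zero]
      have hai : a ≠ i := fun h => hi (h ▸ ha)
      have hci : c ≠ i := fun h => hi (h ▸ hc)
      have hdi : d ≠ i := fun h => hi (h ▸ hd)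
      apply hw a ha c hc d hd hac hcd
      · simpa [hai, hci] using h1
      · simpa [hai, hdi] using h2
  have h1 := congrArg (eval z) hG
  rw [map_sub, hge, map_zero, sub_eq_zero] at h1
  rw [← h1]
  congr 3
  ring

/-- inductively generated evaluation points -/
inductive Dyck : Finset ι → (ι → ℂ) → Prop
  | nil (z : ι → ℂ) : Dyck ∅ z
  | arch (s : Finset ι) (z : ι → ℂ) (i j : ι) (hi : i ∈ s) (hj : j ∈ s) (hij : i < j)
      (hb : inner_ s i j = ∅) (hzi : z i = q⁻¹) (hzj : z j = q)
      (h : Dyck ((s.erase i).erase j) z) : Dyck s z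

theorem Dyck.val {s : Finset ι} {z : ι → ℂ} (h : Dyck s z) : ∀ k ∈ s, z k = q ∨ z k = q⁻¹ := by
  induction h with
  | nil z => simp
  | arch s z i j hi hj hij hb hzi hzj h ih =>
    intro k hk
    by_cases h1 : k = i
    · subst h1; right; exact hzi
    by_cases h2 : k = j
    · subst h2; left; exact hzj
    exact ih k (by simp [h1, h2, hk])

theorem Dyck.congr {s : Finset ι} {z : ι → ℂ} (h : Dyck s z) :
    ∀ w : ι → ℂ, (∀ k ∈ s, w k = z k) → Dyck s w := by
  induction h with
  | nil z => intro w _; exact Dyck.nil w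
  | arch s z i j hi hj hij hb hzi hzj h ih =>
    intro w hw
    refine Dyck.arch s w i j hi hj hij hb (by rw [hw i hi, hzi]) (by rw [hw j hj, hzj]) (ih w ?_)
    intro k hk
    simp at hk
    exact hw k hk.2.2

theorem uniq (n : ℕ) : ∀ (s : Finset ι), s.card = 2 * n → ∀ p : MvPolynomial ι ℂ,
    p.totalDegree ≤ n * (n - 1) → Wh s p → (∀ z, Dyck s z → eval z p = 0) → p = 0 := by
  induction n with
  | zero =>
    intro s hs p hp _ hz
    simp at hs
    subst hs
    apply MvPolynomial.funext
    intro z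
    rw [hz z (Dyck.nil z), map_zero]
  | succ n ih =>
    intro s hs p hp hw hD
    rw [Nat.add_sub_cancel] at hp
    apply all_van n s hs p hp
    have main : ∀ m : ℕ, ∀ i ∈ s, ∀ j ∈ s, i < j → (inner_ s i j).card = m → Van i j p := by
      intro m
      induction m using Nat.strong_induction_on with
      | _ m ihm =>
        intro i hi j hj hij hm
        obtain ⟨R, hRw, hRd, hRz, hRe⟩ := arch_red n s hs p hw i j hi hj hij (by
          intro k hk
          have hlt := inner_card_lt s i j k hk
          have hk' := hk
          simp only [inner_, Finset.mem_filter] at hk'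
          exact ⟨ihm _ (hm ▸ hlt.1) i hi k hk'.1 hk'.2.1 rfl,
            ihm _ (hm ▸ hlt.2) k hk'.1 j hj hk'.2.2 rfl⟩)
        have hcard : ((s.erase i).erase j).card = 2 * n := by
          rw [Finset.card_erase_of_mem, Finset.card_erase_of_mem hi, hs]
          · omega
          · simp [hij.ne', hj]
        have hR : R = 0 := by
          by_contra hR0
          have h1 := hRd hR0
          have hle : R.totalDegree + (inner_ s i j).card ≤ n * (n - 1) := by
            rcases n with _ | n
            · simp at hp; omega
            · rw [Nat.add_sub_cancel]; nlinarith
          apply hR0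
          by_cases hb : inner_ s i j = ∅
          · apply ih _ hcard R (by omega) hRw
            intro z hz
            rw [← indep n _ hcard R (by omega) hRw i (by simp) z q⁻¹,
              ← indep n _ hcard R (by omega) hRw j (by simp) _ q]
            have hz2 : Dyck ((s.erase i).erase j)
                (Function.update (Function.update z i q⁻¹) j q) := by
              apply hz.congr
              intro k hk
              simp at hk
              simp [hk.1, hk.2.1]
            apply hRe hb
            · simp [hij.ne]
              rw [q_inv]; linear_combination (-q) * q_cube
            · apply hD
              apply Dyck.arch s _ i j hi hj hij hb _ _ hz2
              · simp [hij.ne]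
              · simp
            · intro k hk
              have h3 := hz2.val k hk
              have h4 : q * Function.update (Function.update z i q⁻¹) j q i = 1 := by
                simp [hij.ne, q_ne_zero]
              rw [h4]
              rcases h3 with h3 | h3 <;> rw [h3]
              · exact q_ne_one
              · rw [q_inv]; exact q_sq_ne_one
          · have : 0 < (inner_ s i j).card := Finset.card_pos.2 (Finset.nonempty_iff_ne_empty.2 hb)
            exact low_deg n _ hcard R (by omega) hRw
        intro z hz
        exact hRz z hz (by rw [hR, map_zero])
    intro i hi j hj hij
    exact main _ i hi j hj hij rfl

end Uniq

section Match

theorem Dyck.matching {ι : Type*} [LinearOrder ι] {s : Finset ι} {z : ι → ℂ} (h : Dyck s z) :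
    ∃ f : ι → ι, (∀ k ∈ s, f k ∈ s) ∧ (∀ k ∈ s, f (f k) = k) ∧ (∀ k ∈ s, f k ≠ k) ∧
      (∀ a ∈ s, ∀ b ∈ s, ∀ c d : ι, a < b → b < c → c < d → f a = c → f b = d → False) ∧
      ∀ k ∈ s, z k = if k < f k then q⁻¹ else q := by
  induction h with
  | nil z => exact ⟨id, by simp, by simp, by simp, by simp, by simp⟩
  | arch s z i j hi hj hij hb hzi hzj h ih =>
    obtain ⟨f, h1, h2, h3, h4, h5⟩ := ih
    have hne : ∀ k ∈ s, k ≠ i → k ≠ j → k ∈ (s.erase i).erase j := by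
      intro k hk hki hkj; simp [hk, hki, hkj]
    have hmem : ∀ k ∈ (s.erase i).erase j, k ∈ s ∧ k ≠ i ∧ k ≠ j := by
      intro k hk; simp at hk; tauto
    have hbt : ∀ k ∈ s, i < k → k < j → False := by
      intro k hk h1 h2
      have : k ∈ inner_ s i j := by simp [inner_, hk, h1, h2]
      rw [hb] at this; simp at this
    set g : ι → ι := fun k => if k = i then j else if k = j then i else f k with hg
    have gi : g i = j := by simp [hg]
    have gj : g j = i := by simp [hg, hij.ne']
    have gk : ∀ k, k ≠ i → k ≠ j → g k = f k := by
      intro k hki hkj; simp [hg, hki, hkj]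
    refine ⟨g, ?_, ?_, ?_, ?_, ?_⟩
    · intro k hk
      by_cases hki : k = i
      · rw [hki, gi]; exact hj
      by_cases hkj : k = j
      · rw [hkj, gj]; exact hi
      rw [gk k hki hkj]
      exact (hmem _ (h1 k (hne k hk hki hkj))).1
    · intro k hk
      by_cases hki : k = i
      · rw [hki, gi, gj]
      by_cases hkj : k = j
      · rw [hkj, gj, gi]
      have hk' := hne k hk hki hkj
      have := hmem _ (h1 k hk')
      rw [gk k hki hkj, gk _ this.2.1 this.2.2, h2 k hk']
    · intro k hk
      by_cases hki : k = i
      · rw [hki, gi]; exact hij.ne'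
      by_cases hkj : k = j
      · rw [hkj, gj]; exact hij.ne
      rw [gk k hki hkj]
      exact h3 k (hne k hk hki hkj)
    · intro a ha b hb' c d hab hbc hcd hfa hfb
      by_cases hai : a = i
      · subst hai
        rw [gi] at hfa; subst hfa
        exact hbt b hb' hab hbc
      by_cases haj : a = j
      · subst haj
        rw [gj] at hfa; subst hfa
        exact absurd (hab.trans hbc) (not_lt.2 hij.le)
      have ha' := hne a ha hai haj
      rw [gk a hai haj] at hfa
      have hc := hmem _ (h1 a ha')
      rw [hfa] at hc
      by_cases hbi : b = i
      · subst hbi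
        rw [gi] at hfb; subst hfb
        exact hbt c hc.1 hbc hcd
      by_cases hbj : b = j
      · subst hbj
        rw [gj] at hfb; subst hfb
        exact absurd (hbc.trans hcd) (not_lt.2 hij.le)
      rw [gk b hbi hbj] at hfb
      exact h4 a ha' b (hne b hb' hbi hbj) c d hab hbc hcd hfa hfb
    · intro k hk
      by_cases hki : k = i
      · rw [hki, gi, if_pos hij, hzi]
      by_cases hkj : k = j
      · rw [hkj, gj, if_neg (not_lt.2 hij.le), hzj]
      rw [gk k hki hkj]
      exact h5 k (hne k hk hki hkj)

theorem Dyck.ncm {n : ℕ} {z : Fin (2 * n) → ℂ} (h : Dyck Finset.univ z) :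
    ∃ π : NCM n, z = fun k => if k < π.f k then q⁻¹ else q := by
  obtain ⟨f, h1, h2, h3, h4, h5⟩ := h.matching
  refine ⟨⟨f, fun k => h2 k (Finset.mem_univ _), fun k => h3 k (Finset.mem_univ _),
    fun a b c d => h4 a (Finset.mem_univ _) b (Finset.mem_univ _) c d⟩, ?_⟩
  funext k
  exact h5 k (Finset.mem_univ _)

theorem IsWheel.wh {n : ℕ} {p : MvPolynomial (Fin (2 * n)) ℂ} (h : IsWheel n p) :
    Wh Finset.univ p := by
  intro i _ j _ k _ hij hjk z hj hk
  have h1 := congrArg (eval z) (h.2 i j k hij hjk)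
  rw [map_zero] at h1
  have h2 := eval_bind (fun l : Fin (2 * n) =>
      if l = j then C (q ^ 2) * X i
      else if l = k then C (q ^ 4) * X i
      else (X l : MvPolynomial (Fin (2 * n)) ℂ)) p z
  have h3 : (fun l : Fin (2 * n) => eval z (if l = j then C (q ^ 2) * X i
      else if l = k then C (q ^ 4) * X i
      else (X l : MvPolynomial (Fin (2 * n)) ℂ))) = z := by
    funext l
    split_ifs with h4 h5
    · subst h4; rw [hj]; simp
    · subst h5; rw [hk]; simp
    · simp
  rw [h3] at h2
  rw [← h2]
  exact h1

/-- same content: evaluation points of two matchings differ by a permutation -/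
theorem NCM.card_open {n : ℕ} (π : NCM n) :
    (Finset.univ.filter (fun k => k < π.f k)).card = n := by
  have h1 : (Finset.univ.filter (fun k => k < π.f k)).card =
      (Finset.univ.filter (fun k => ¬ k < π.f k)).card := by
    apply Finset.card_bij (fun k _ => π.f k)
    · intro k hk
      simp at hk ⊢
      rw [π.invol]; exact hk.le
    · intro a _ b _ hab
      rw [← π.invol a, hab, π.invol]
    · intro k hk
      refine ⟨π.f k, ?_, π.invol k⟩
      simp at hk ⊢
      rw [π.invol]
      exact lt_of_le_of_ne hk (π.nofix k)
  have h2 := Finset.card_filter_add_card_filter_not (s := Finset.univ) (fun k => k < π.f k)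
  simp only [Finset.card_univ, Fintype.card_fin] at h2
  omega

theorem exists_perm {α : Type*} [Fintype α] (P Q : α → Prop) [DecidablePred P] [DecidablePred Q]
    (h : (Finset.univ.filter P).card = (Finset.univ.filter Q).card) :
    ∃ σ : Equiv.Perm α, ∀ a, Q (σ a) ↔ P a := by
  have h1 : Fintype.card {a // P a} = Fintype.card {a // Q a} := by
    rw [Fintype.card_subtype, Fintype.card_subtype, h]
  obtain ⟨e⟩ := Fintype.card_eq.1 h1
  refine ⟨e.extendSubtype, fun a => ?_⟩
  constructor
  · intro hq
    by_contra hp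
    exact e.extendSubtype_not_mem a hp hq
  · intro hp
    exact e.extendSubtype_mem a hp

end Match

section Schur

/-- the exponents `0,1,3,4,6,7,…` -/
def ex (j : ℕ) : ℕ := 3 * (j / 2) + j % 2

/-- alternant -/
noncomputable def alt {A : Type*} [CommRing A] {N : ℕ} (z : Fin N → A) : A :=
  (Matrix.of fun i j : Fin N => z i ^ ex j).det

/-- ordered pairs -/
def prs (N : ℕ) : Finset (Fin N × Fin N) :=
  (Finset.univ ×ˢ Finset.univ).filter (fun t => t.1 < t.2)

/-- range Vandermonde product -/
def VR {A : Type*} [CommRing A] (N : ℕ) (w : ℕ → A) : A :=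
  ∏ j ∈ Finset.range N, ∏ i ∈ Finset.range j, (w j - w i)

theorem prs_vdm {A : Type*} [CommRing A] {N : ℕ} (z : Fin N → A) :
    ∏ t ∈ prs N, (z t.2 - z t.1) = (Matrix.vandermonde z).det := by
  rw [Matrix.det_vandermonde, prs, Finset.prod_filter, Finset.prod_product]
  apply Finset.prod_congr rfl
  intro i _
  rw [← Finset.prod_filter]
  apply Finset.prod_congr _ (fun _ _ => rfl)
  ext j; simp

theorem vdm_VR {A : Type*} [CommRing A] (N : ℕ) (w : ℕ → A) :
    (Matrix.vandermonde (fun i : Fin N => w i)).det = VR N w := by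
  rw [← prs_vdm, prs, Finset.prod_filter, Finset.prod_product_right, VR,
    ← Fin.prod_univ_eq_prod_range (fun j => ∏ i ∈ Finset.range j, (w j - w i))]
  apply Finset.prod_congr rfl
  intro j _
  have h1 := Fin.prod_univ_eq_prod_range (fun i => if i < (j : ℕ) then w j - w i else 1) N
  simp only [Fin.lt_def]
  rw [h1, ← Finset.prod_filter]
  apply Finset.prod_congr _ (fun _ _ => rfl)
  ext i
  have := j.2
  simp; omega

theorem alt_map {A B : Type*} [CommRing A] [CommRing B] (f : A →+* B) {N : ℕ} (z : Fin N → A) :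
    f (alt z) = alt (fun i => f (z i)) := by
  unfold alt
  rw [RingHom.map_det]
  congr 1
  ext i j
  simp

theorem alt_eq_zero_of_eq {A : Type*} [CommRing A] {N : ℕ} (z : Fin N → A) (i j : Fin N)
    (hij : i ≠ j) (h : z i = z j) : alt z = 0 := by
  unfold alt
  apply Matrix.det_zero_of_row_eq hij
  funext k
  simp [h]

theorem alt_perm {A : Type*} [CommRing A] {N : ℕ} (z : Fin N → A) (σ : Equiv.Perm (Fin N)) :
    alt (fun i => z (σ i)) = (Equiv.Perm.sign σ : ℤ) * alt z := by
  unfold alt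
  rw [← Matrix.det_permute]
  rfl

theorem vdm_perm {A : Type*} [CommRing A] {N : ℕ} (z : Fin N → A) (σ : Equiv.Perm (Fin N)) :
    (Matrix.vandermonde (fun i => z (σ i))).det =
      (Equiv.Perm.sign σ : ℤ) * (Matrix.vandermonde z).det := by
  rw [← Matrix.det_permute]
  rfl

theorem alt_wheel {N : ℕ} (z : Fin N → ℂ) (i j k : Fin N) (hij : i < j) (hjk : j < k)
    (hj : z j = q ^ 2 * z i) (hk : z k = q ^ 4 * z i) : alt z = 0 := by
  unfold alt
  rw [← Matrix.exists_vecMul_eq_zero_iff]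
  have hik := hij.trans hjk
  refine ⟨fun l => (if l = i then 1 else 0) + (if l = j then q ^ 2 else 0) +
    (if l = k then q ^ 4 else 0), ?_, ?_⟩
  · intro h
    have := congrFun h i
    simp [hij.ne, hik.ne] at this
  · funext m
    simp only [Matrix.vecMul, dotProduct, add_mul, Finset.sum_add_distrib, ite_mul, zero_mul,
      Finset.sum_ite_eq', Finset.mem_univ, if_true, Matrix.of_apply, Pi.zero_apply, hj, hk]
    have hq3 := q_cube
    have hqq := q_quad
    have e2 : (q ^ 2) ^ ex m * q ^ 2 + (q ^ 4) ^ ex m * q ^ 4 + 1 = 0 := by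
      have h3 : ∀ a b : ℕ, q ^ (3 * a + b) = q ^ b := by
        intro a b; rw [pow_add, pow_mul, hq3, one_pow, one_mul]
      rw [← pow_mul, ← pow_mul, ← pow_add, ← pow_add]
      unfold ex
      rcases Nat.mod_two_eq_zero_or_one (m : ℕ) with hm | hm <;> rw [hm]
      · rw [show 2 * (3 * ((m : ℕ) / 2) + 0) + 2 = 3 * (2 * ((m : ℕ) / 2)) + 2 by ring,
          show 4 * (3 * ((m : ℕ) / 2) + 0) + 4 = 3 * (4 * ((m : ℕ) / 2) + 1) + 1 by ring, h3, h3]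
        linear_combination hqq
      · rw [show 2 * (3 * ((m : ℕ) / 2) + 1) + 2 = 3 * (2 * ((m : ℕ) / 2) + 1) + 1 by ring,
          show 4 * (3 * ((m : ℕ) / 2) + 1) + 4 = 3 * (4 * ((m : ℕ) / 2) + 2) + 2 by ring, h3, h3]
        linear_combination hqq
    rw [mul_pow, mul_pow]
    linear_combination (z i ^ ex m) * e2

theorem sum_ex (n : ℕ) : ∑ j ∈ Finset.range (2 * n), ex j + 2 * n = 3 * (n * n) := by
  induction n with
  | zero => simp
  | succ n ih =>
    rw [show 2 * (n + 1) = 2 * n + 1 + 1 by ring, Finset.sum_range_succ, Finset.sum_range_succ]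
    have h1 : ex (2 * n) = 3 * n := by unfold ex; omega
    have h2 : ex (2 * n + 1) = 3 * n + 1 := by unfold ex; omega
    rw [h1, h2]; nlinarith

theorem alt_deg (n : ℕ) :
    (alt (fun i => (X i : MvPolynomial (Fin (2 * n)) ℂ))).totalDegree + 2 * n ≤ 3 * (n * n) := by
  rw [← sum_ex n]
  apply Nat.add_le_add_right
  unfold alt
  rw [Matrix.det_apply]
  apply totalDegree_finsetSum_le
  intro σ _
  have h1 : (Equiv.Perm.sign σ • ∏ i, (Matrix.of fun i j : Fin (2 * n) =>
      (X i : MvPolynomial (Fin (2 * n)) ℂ) ^ ex j) (σ i) i).totalDegree ≤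
      (∏ i, (Matrix.of fun i j : Fin (2 * n) =>
      (X i : MvPolynomial (Fin (2 * n)) ℂ) ^ ex j) (σ i) i).totalDegree := by
    rcases Int.units_eq_one_or (Equiv.Perm.sign σ) with h | h <;> rw [h]
    · simp
    · simp
  refine h1.trans ((totalDegree_finsetProd _ _).trans ?_)
  rw [← Fin.sum_univ_eq_sum_range]
  apply Finset.sum_le_sum
  intro i _
  simp

/-- Existence of the Schur polynomial. -/
theorem schur_exists (n : ℕ) : ∃ S : MvPolynomial (Fin (2 * n)) ℂ,
    alt (fun i => (X i : MvPolynomial (Fin (2 * n)) ℂ)) =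
      (∏ t ∈ prs (2 * n), (X t.2 - X t.1)) * S ∧ S.totalDegree ≤ n * (n - 1) := by
  have hm : ∀ t ∈ prs (2 * n), t.1 < t.2 := by
    intro t ht; simpa [prs] using ht
  obtain ⟨S, hS⟩ := prod_dvd (prs (2 * n)) (fun t => t.2) (fun t => t.1) (fun _ => 1)
    (alt (fun i => (X i : MvPolynomial (Fin (2 * n)) ℂ)))
    (fun t ht => (hm t ht).ne')
    (by
      intro t ht z hz
      rw [alt_map]
      apply alt_eq_zero_of_eq _ t.2 t.1 (hm t ht).ne'
      simpa using hz)
    (by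
      rintro ⟨a, b⟩ ht ⟨c, d⟩ hu hne
      have h1 := hm _ ht
      have h2 := hm _ hu
      simp only at h1 h2 ⊢
      by_cases hca : c = a
      · subst hca
        have hbd : d ≠ b := by rintro rfl; exact hne rfl
        refine ⟨fun l => if l = c then 1 else if l = b then 1 else 0, ?_, ?_⟩
        · simp
        · simp [h2.ne', hbd]
      · by_cases hcb : c = b
        · subst hcb
          refine ⟨fun l => if l = a then 1 else if l = c then 1 else 0, ?_, ?_⟩
          · simp
          · have : d ≠ a := (h1.trans h2).ne'
            simp [h2.ne', this]
        · refine ⟨fun l => if l = c then 1 else 0, ?_, ?_⟩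
          · simp [Ne.symm hca, Ne.symm hcb]
          · simp [h2.ne'])
  refine ⟨S, ?_, ?_⟩
  · rw [hS]; simp
  · by_cases hS0 : S = 0
    · simp [hS0]
    have e := prod_deg (prs (2 * n)) (fun t => t.2) (fun t => t.1) (fun _ => 1)
      (fun t ht => (hm t ht).ne') S hS0
    rw [← hS] at e
    have hc := card_pairs (Finset.univ : Finset (Fin (2 * n)))
    change 2 * (prs (2 * n)).card + _ = _ at hc
    simp only [Finset.card_univ, Fintype.card_fin] at hc
    have hd := alt_deg n
    rcases n with _ | n
    · show S.totalDegree ≤ 0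
      omega
    · rw [Nat.add_sub_cancel]; nlinarith

theorem schur_hom {n : ℕ} {S : MvPolynomial (Fin (2 * n)) ℂ}
    (hS : alt (fun i => (X i : MvPolynomial (Fin (2 * n)) ℂ)) =
      (∏ t ∈ prs (2 * n), (X t.2 - X t.1)) * S) {A : Type*} [CommRing A]
    (f : MvPolynomial (Fin (2 * n)) ℂ →+* A) :
    alt (fun i => f (X i)) = (Matrix.vandermonde (fun i => f (X i))).det * f S := by
  rw [← alt_map, hS, map_mul, ← prs_vdm, map_prod]
  simp

theorem schur_symm {n : ℕ} {S : MvPolynomial (Fin (2 * n)) ℂ}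
    (hS : alt (fun i => (X i : MvPolynomial (Fin (2 * n)) ℂ)) =
      (∏ t ∈ prs (2 * n), (X t.2 - X t.1)) * S) (σ : Equiv.Perm (Fin (2 * n))) :
    rename σ S = S := by
  have h1 := schur_hom hS (rename σ : MvPolynomial (Fin (2 * n)) ℂ →ₐ[ℂ] _).toRingHom
  have h2 := schur_hom hS (RingHom.id _)
  simp only [AlgHom.toRingHom_eq_coe, RingHom.coe_coe, rename_X, RingHom.id_apply] at h1 h2
  rw [alt_perm (fun i => (X i : MvPolynomial (Fin (2 * n)) ℂ)) σ,
    vdm_perm (fun i => (X i : MvPolynomial (Fin (2 * n)) ℂ)) σ, h2, mul_assoc] at h1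
  have h3 : (((Equiv.Perm.sign σ : ℤ)) : MvPolynomial (Fin (2 * n)) ℂ) ≠ 0 := by
    rcases Int.units_eq_one_or (Equiv.Perm.sign σ) with h | h <;> rw [h] <;> simp
  have h4 : (Matrix.vandermonde fun i => (X i : MvPolynomial (Fin (2 * n)) ℂ)).det ≠ 0 := by
    rw [Matrix.det_vandermonde_ne_zero_iff]
    exact X_injective
  exact (mul_left_cancel₀ h4 (mul_left_cancel₀ h3 h1)).symm

theorem schur_wheel {n : ℕ} {S : MvPolynomial (Fin (2 * n)) ℂ}
    (hS : alt (fun i => (X i : MvPolynomial (Fin (2 * n)) ℂ)) =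
      (∏ t ∈ prs (2 * n), (X t.2 - X t.1)) * S) : Wh Finset.univ S := by
  intro i _ j _ k _ hij hjk z hj hk
  have hik := hij.trans hjk
  set g : Fin (2 * n) → MvPolynomial (Fin (2 * n)) ℂ := fun l =>
    if l = j then C (q ^ 2) * X i else if l = k then C (q ^ 4) * X i else X l with hg
  have hg1 : ∀ z : Fin (2 * n) → ℂ, (fun l => eval z (g l)) =
      fun l => if l = j then q ^ 2 * z i else if l = k then q ^ 4 * z i else z l := by
    intro z
    funext l
    simp only [hg]
    split_ifs <;> simp
  have hz : (fun l => eval z (g l)) = z := by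
    rw [hg1]
    funext l
    split_ifs with h1 h2
    · rw [h1, hj]
    · rw [h2, hk]
    · rfl
  rw [← hz]
  apply dens g (∏ t ∈ prs (2 * n), (X t.2 - X t.1))
  · intro w
    rw [← hS, alt_map, hg1]
    simp only [eval_X]
    apply alt_wheel _ i j k hij hjk
    · simp [hij.ne, hik.ne]
    · simp [hij.ne, hik.ne, hjk.ne']
  · show eval (fun l => eval (fun l : Fin (2 * n) => (((l : ℕ) + 1 : ℕ) : ℂ)) (g l)) _ ≠ 0
    rw [hg1, map_prod]
    simp only [map_sub, eval_X]
    intro h0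
    have hv := prs_vdm (fun l : Fin (2 * n) => if l = j then q ^ 2 * (((i : ℕ) + 1 : ℕ) : ℂ) else
        if l = k then q ^ 4 * (((i : ℕ) + 1 : ℕ) : ℂ) else (((l : ℕ) + 1 : ℕ) : ℂ))
    beta_reduce at hv
    rw [h0] at hv
    refine (Matrix.det_vandermonde_ne_zero_iff.2 ?_) hv.symm
    have hqn : ‖q‖ = 1 := Complex.norm_eq_one_of_pow_eq_one q_cube (by norm_num)
    have hi0 : (((i : ℕ) + 1 : ℕ) : ℂ) ≠ 0 := Nat.cast_ne_zero.2 (Nat.succ_ne_zero _)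
    -- norm function
    have hnorm : ∀ l : Fin (2 * n), ‖(if l = j then q ^ 2 * (((i : ℕ) + 1 : ℕ) : ℂ) else
        if l = k then q ^ 4 * (((i : ℕ) + 1 : ℕ) : ℂ) else (((l : ℕ) + 1 : ℕ) : ℂ))‖ =
        (((if l = j then i else if l = k then i else l : Fin (2 * n)) : ℕ) + 1 : ℕ) := by
      intro l
      split_ifs
      · rw [norm_mul, norm_pow, hqn, one_pow, one_mul, Complex.norm_natCast]
      · rw [norm_mul, norm_pow, hqn, one_pow, one_mul, Complex.norm_natCast]
      · rw [Complex.norm_natCast]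
    have a1 : q ^ 2 * (((i : ℕ) + 1 : ℕ) : ℂ) ≠ q ^ 4 * (((i : ℕ) + 1 : ℕ) : ℂ) := by
      intro h; rw [q_four] at h; exact q_sq_ne_q (mul_right_cancel₀ hi0 h)
    have a2 : q ^ 2 * (((i : ℕ) + 1 : ℕ) : ℂ) ≠ (((i : ℕ) + 1 : ℕ) : ℂ) := by
      intro h; exact q_sq_ne_one (mul_right_cancel₀ hi0 (h.trans (one_mul _).symm))
    have a3 : q ^ 4 * (((i : ℕ) + 1 : ℕ) : ℂ) ≠ (((i : ℕ) + 1 : ℕ) : ℂ) := by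
      intro h; rw [q_four] at h
      exact q_ne_one (mul_right_cancel₀ hi0 (h.trans (one_mul _).symm))
    intro l m hlm
    simp only at hlm
    have hN := congrArg norm hlm
    rw [hnorm, hnorm] at hN
    have hN' : (if l = j then i else if l = k then i else l : Fin (2 * n)) =
        (if m = j then i else if m = k then i else m : Fin (2 * n)) := by
      apply Fin.ext
      have : ((if l = j then i else if l = k then i else l : Fin (2 * n)) : ℕ) + 1 =
        ((if m = j then i else if m = k then i else m : Fin (2 * n)) : ℕ) + 1 := by
        exact_mod_cast hN
      omega
    clear hnorm hN
    by_cases l1 : l = j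
    · rw [if_pos l1] at hlm hN'
      by_cases m1 : m = j
      · rw [l1, m1]
      · rw [if_neg m1] at hlm hN'
        by_cases m2 : m = k
        · rw [if_pos m2] at hlm
          exact absurd hlm a1
        · rw [if_neg m2] at hlm hN'
          rw [← hN'] at hlm
          exact absurd hlm a2
    · rw [if_neg l1] at hlm hN'
      by_cases l2 : l = k
      · rw [if_pos l2] at hlm hN'
        by_cases m1 : m = j
        · rw [if_pos m1] at hlm
          exact absurd hlm.symm a1
        · rw [if_neg m1] at hlm hN'
          by_cases m2 : m = k
          · rw [l2, m2]
          · rw [if_neg m2] at hlm hN'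
            rw [← hN'] at hlm
            exact absurd hlm a3
      · rw [if_neg l2] at hlm hN'
        by_cases m1 : m = j
        · rw [if_pos m1] at hlm hN'
          rw [hN'] at hlm
          exact absurd hlm.symm a2
        · rw [if_neg m1] at hlm hN'
          by_cases m2 : m = k
          · rw [if_pos m2] at hlm hN'
            rw [hN'] at hlm
            exact absurd hlm.symm a3
          · rw [if_neg m2] at hN'
            exact hN'

end Schur

section Numeric

theorem VR_succ2 {A : Type*} [CommRing A] (n : ℕ) (w : ℕ → A) :
    VR (2 * (n + 1)) w = VR (2 * n) w * (∏ i ∈ Finset.range (2 * n), (w (2 * n) - w i)) *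
      ∏ i ∈ Finset.range (2 * n + 1), (w (2 * n + 1) - w i) := by
  unfold VR
  rw [show 2 * (n + 1) = 2 * n + 1 + 1 by ring, Finset.prod_range_succ, Finset.prod_range_succ]

theorem prod_range_two_mul {A : Type*} [CommRing A] (n : ℕ) (g : ℕ → A) :
    ∏ i ∈ Finset.range (2 * n), g i = ∏ k ∈ Finset.range n, (g (2 * k) * g (2 * k + 1)) := by
  induction n with
  | zero => simp
  | succ n ih =>
    rw [show 2 * (n + 1) = 2 * n + 1 + 1 by ring, Finset.prod_range_succ, Finset.prod_range_succ,
      ih, Finset.prod_range_succ, mul_assoc]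

theorem prod_id (m : ℕ) : ∏ i ∈ Finset.range m, ((m : ℂ) - (i : ℂ)) = (m.factorial : ℂ) := by
  rw [← Finset.prod_range_reflect, ← Finset.prod_range_add_one_eq_factorial]
  push_cast
  apply Finset.prod_congr rfl
  intro j hj
  have hj' := Finset.mem_range.1 hj
  rw [show m - 1 - j = m - (j + 1) by omega, Nat.cast_sub (by omega)]
  push_cast; ring

theorem prod_ex_aux (n : ℕ) :
    (∏ k ∈ Finset.range n, ((3 * ((k : ℂ) + 1)) * (3 * ((k : ℂ) + 1) - 1))) *
    ((∏ k ∈ Finset.range n, ((3 * ((k : ℂ) + 1) + 1) * (3 * ((k : ℂ) + 1))))) =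
      3 ^ n * (n.factorial : ℂ) * ((3 * n + 1).factorial : ℂ) := by
  induction n with
  | zero => simp
  | succ n ih =>
    rw [Finset.prod_range_succ, Finset.prod_range_succ]
    rw [show 3 * (n + 1) + 1 = 3 * n + 1 + 1 + 1 + 1 by ring, Nat.factorial_succ (3 * n + 1 + 1 + 1),
      Nat.factorial_succ (3 * n + 1 + 1), Nat.factorial_succ (3 * n + 1), Nat.factorial_succ n]
    push_cast
    rw [pow_succ]
    linear_combination (3 * ((n : ℂ) + 1) * (3 * ((n : ℂ) + 1) - 1) *
      ((3 * ((n : ℂ) + 1) + 1) * (3 * ((n : ℂ) + 1)))) * ih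

theorem ex_even (n : ℕ) : ex (2 * n) = 3 * n := by unfold ex; omega
theorem ex_odd (n : ℕ) : ex (2 * n + 1) = 3 * n + 1 := by unfold ex; omega

theorem prod_ex (n : ℕ) :
    (∏ i ∈ Finset.range (2 * n), ((ex (2 * n) : ℂ) - (ex i : ℂ))) *
      ∏ i ∈ Finset.range (2 * n + 1), ((ex (2 * n + 1) : ℂ) - (ex i : ℂ)) =
      3 ^ n * (n.factorial : ℂ) * ((3 * n + 1).factorial : ℂ) := by
  rw [← prod_ex_aux, Finset.prod_range_succ, prod_range_two_mul, prod_range_two_mul]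
  simp only [ex_even, ex_odd]
  rw [← Finset.prod_range_reflect, ← Finset.prod_range_reflect (fun k =>
    ((((3 * n + 1 : ℕ)) : ℂ) - ((3 * k : ℕ) : ℂ)) * ((((3 * n + 1 : ℕ)) : ℂ) - ((3 * k + 1 : ℕ) : ℂ)))]
  have e : ((((3 * n + 1 : ℕ)) : ℂ) - ((3 * n : ℕ) : ℂ)) = 1 := by push_cast; ring
  rw [e, mul_one]
  congr 1 <;>
  · apply Finset.prod_congr rfl
    intro j hj
    have hj' := Finset.mem_range.1 hj
    have : ((n - 1 - j : ℕ) : ℂ) = (n : ℂ) - (j + 1) := by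
      rw [show n - 1 - j = n - (j + 1) by omega, Nat.cast_sub (by omega)]
      push_cast; ring
    push_cast
    rw [this]; ring

theorem ASM_succ (n : ℕ) : ASM (n + 1) * (((2 * n).factorial : ℂ) * ((2 * n + 1).factorial : ℂ)) =
    ASM n * ((n.factorial : ℂ) * ((3 * n + 1).factorial : ℂ)) := by
  unfold ASM
  rw [Finset.prod_div_distrib, Finset.prod_div_distrib, Finset.prod_range_succ]
  have hne : ∀ m : ℕ, ∏ j ∈ Finset.range m, ((n + j).factorial : ℂ) ≠ 0 := fun m =>
    Finset.prod_ne_zero_iff.2 fun j _ => Nat.cast_ne_zero.2 (Nat.factorial_ne_zero _)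
  have hne' : ∏ j ∈ Finset.range (n + 1), ((n + 1 + j).factorial : ℂ) ≠ 0 :=
    Finset.prod_ne_zero_iff.2 fun j _ => Nat.cast_ne_zero.2 (Nat.factorial_ne_zero _)
  have h : (∏ j ∈ Finset.range (n + 1), ((n + 1 + j).factorial : ℂ)) * (n.factorial : ℂ) =
      (∏ j ∈ Finset.range n, ((n + j).factorial : ℂ)) *
        (((2 * n).factorial : ℂ) * ((2 * n + 1).factorial : ℂ)) := by
    have h1 := Finset.prod_range_succ (fun j => ((n + j).factorial : ℂ)) (n + 1)
    have h2 := Finset.prod_range_succ' (fun j => ((n + j).factorial : ℂ)) (n + 1)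
    have h3 := Finset.prod_range_succ (fun j => ((n + j).factorial : ℂ)) n
    rw [h3] at h1
    rw [h1] at h2
    rw [show n + n = 2 * n by ring, show n + (n + 1) = 2 * n + 1 by ring, add_zero] at h2
    rw [← mul_assoc, h2]
    congr 1
    apply Finset.prod_congr rfl
    intro j _
    rw [show n + 1 + j = n + (j + 1) by ring]
  have hn := hne n
  rw [div_mul_eq_mul_div, div_mul_eq_mul_div, div_eq_div_iff hne' hn]
  linear_combination (-(∏ j ∈ Finset.range n, ((3 * j + 1).factorial : ℂ)) *
    ((3 * n + 1).factorial : ℂ)) * h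

theorem ident3 (n : ℕ) : VR (2 * n) (fun j => (ex j : ℂ)) =
    (∏ j ∈ Finset.range n, (3 : ℂ) ^ j) * ASM n * VR (2 * n) (fun j => (j : ℂ)) := by
  induction n with
  | zero => simp [VR, ASM]
  | succ n ih =>
    rw [VR_succ2, VR_succ2, ih, mul_assoc _ (Finset.prod _ _), prod_ex, prod_id, prod_id,
      Finset.prod_range_succ]
    linear_combination (-(∏ j ∈ Finset.range n, (3 : ℂ) ^ j) * 3 ^ n *
      VR (2 * n) (fun j => (j : ℂ))) * ASM_succ n

theorem VR_id_ne (n : ℕ) : VR n (fun j => (j : ℂ)) ≠ 0 := by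
  unfold VR
  refine Finset.prod_ne_zero_iff.2 fun j _ => Finset.prod_ne_zero_iff.2 fun i hi => ?_
  have := Finset.mem_range.1 hi
  rw [sub_ne_zero]
  exact fun h => this.ne' (Nat.cast_injective h)

end Numeric

section Ident

theorem alt_pow {A : Type*} [CommRing A] (N : ℕ) (t : A) :
    alt (fun i : Fin N => t ^ (i : ℕ)) = VR N (fun j => t ^ ex j) := by
  rw [← vdm_VR, ← Matrix.det_transpose]
  unfold alt
  congr 1
  ext i j
  simp only [Matrix.of_apply, Matrix.transpose_apply, Matrix.vandermonde_apply]
  rw [← pow_mul, ← pow_mul, mul_comm]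

/-- the quotient of the Vandermonde in powers of `X` by powers of `X - 1` -/
noncomputable def GV (N : ℕ) (u : ℕ → ℕ) : Polynomial ℂ :=
  ∏ j ∈ Finset.range N, ∏ i ∈ Finset.range j,
    (Polynomial.X ^ u i * ∑ l ∈ Finset.range (u j - u i), Polynomial.X ^ l)

theorem VR_pow (N : ℕ) (u : ℕ → ℕ) (hu : StrictMono u) :
    VR N (fun j => (Polynomial.X : Polynomial ℂ) ^ u j) =
      (∏ j ∈ Finset.range N, ∏ _i ∈ Finset.range j, ((Polynomial.X : Polynomial ℂ) - 1)) *
        GV N u := by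
  unfold VR GV
  rw [← Finset.prod_mul_distrib]
  apply Finset.prod_congr rfl
  intro j _
  rw [← Finset.prod_mul_distrib]
  apply Finset.prod_congr rfl
  intro i hi
  have h := hu (Finset.mem_range.1 hi)
  have h2 : (Polynomial.X : Polynomial ℂ) ^ u j = Polynomial.X ^ u i * Polynomial.X ^ (u j - u i) := by
    rw [← pow_add]; congr 1; omega
  beta_reduce
  rw [h2]
  linear_combination (-(Polynomial.X : Polynomial ℂ) ^ u i) *
    (geom_sum_mul (Polynomial.X : Polynomial ℂ) (u j - u i))

theorem GV_eval (N : ℕ) (u : ℕ → ℕ) (hu : StrictMono u) :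
    (GV N u).eval 1 = VR N (fun j => (u j : ℂ)) := by
  unfold VR GV
  rw [Polynomial.eval_prod]
  apply Finset.prod_congr rfl
  intro j _
  rw [Polynomial.eval_prod]
  apply Finset.prod_congr rfl
  intro i hi
  have h := hu (Finset.mem_range.1 hi)
  simp [Polynomial.eval_finsetSum, Nat.cast_sub h.le]

theorem X_sub_one_ne : (Polynomial.X : Polynomial ℂ) - 1 ≠ 0 := by
  have := Polynomial.X_sub_C_ne_zero (1 : ℂ)
  simpa using this

theorem ex_mono : StrictMono ex := by
  apply strictMono_nat_of_lt_succ
  intro n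
  unfold ex
  omega

theorem eval_one_aeval {n : ℕ} (g : Fin n → Polynomial ℂ) (S : MvPolynomial (Fin n) ℂ) :
    (aeval g S).eval 1 = eval (fun i => (g i).eval 1) S := by
  have h : ((Polynomial.evalRingHom (1 : ℂ)).comp
      (aeval g : MvPolynomial (Fin n) ℂ →ₐ[ℂ] Polynomial ℂ).toRingHom) =
      (eval (fun i => (g i).eval 1) : MvPolynomial (Fin n) ℂ →+* ℂ) := by
    apply MvPolynomial.ringHom_ext
    · intro r; simp [Polynomial.algebraMap_eq]
    · intro i; simp
  exact congrArg (fun φ => φ S) h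

theorem ident1 {n : ℕ} {S : MvPolynomial (Fin (2 * n)) ℂ}
    (hS : alt (fun i => (X i : MvPolynomial (Fin (2 * n)) ℂ)) =
      (∏ t ∈ prs (2 * n), (X t.2 - X t.1)) * S) :
    VR (2 * n) (fun j => (ex j : ℂ)) = VR (2 * n) (fun j => (j : ℂ)) * evalOne S := by
  have h := schur_hom hS (aeval (fun i : Fin (2 * n) => (Polynomial.X : Polynomial ℂ) ^ (i : ℕ))
    : MvPolynomial (Fin (2 * n)) ℂ →ₐ[ℂ] Polynomial ℂ).toRingHom
  simp only [AlgHom.toRingHom_eq_coe, RingHom.coe_coe, aeval_X] at h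
  have hv := vdm_VR (2 * n) (fun i => (Polynomial.X : Polynomial ℂ) ^ i)
  beta_reduce at hv
  rw [alt_pow, hv, VR_pow _ _ ex_mono, VR_pow _ (fun i => i) strictMono_id, mul_assoc] at h
  have h2 := mul_left_cancel₀ (Finset.prod_ne_zero_iff.2 fun j _ =>
    Finset.prod_ne_zero_iff.2 fun i _ => X_sub_one_ne) h
  have h3 := congrArg (Polynomial.eval 1) h2
  rw [GV_eval _ _ ex_mono, Polynomial.eval_mul, GV_eval _ (fun i => i) strictMono_id,
    eval_one_aeval] at h3
  simpa [evalOne] using h3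

/-- interleaved point -/
def il {A : Type*} [CommRing A] (a b : A) (x : ℕ → A) (m : ℕ) : A :=
  (if m % 2 = 0 then a else b) * x (m / 2)

theorem il_even {A : Type*} [CommRing A] (a b : A) (x : ℕ → A) (k : ℕ) :
    il a b x (2 * k) = a * x k := by
  unfold il
  rw [if_pos (by omega), show 2 * k / 2 = k by omega]

theorem il_odd {A : Type*} [CommRing A] (a b : A) (x : ℕ → A) (k : ℕ) :
    il a b x (2 * k + 1) = b * x k := by
  unfold il
  rw [if_neg (by omega), show (2 * k + 1) / 2 = k by omega]

theorem VR_succ {A : Type*} [CommRing A] (n : ℕ) (w : ℕ → A) :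
    VR (n + 1) w = VR n w * (∏ i ∈ Finset.range n, (w n - w i)) := by
  unfold VR
  rw [Finset.prod_range_succ]

theorem VR_il {A : Type*} [CommRing A] (a b : A) (hab : a * b = 1) (hab2 : a ^ 2 + b ^ 2 = -1)
    (x : ℕ → A) (n : ℕ) :
    VR (2 * n) (il a b x) = (∏ k ∈ Finset.range n, (b * x k - a * x k)) * VR n x *
      VR n (fun k => x k ^ 3) := by
  induction n with
  | zero => simp [VR]
  | succ n ih =>
    rw [VR_succ2, VR_succ, VR_succ, ih, Finset.prod_range_succ _ (2 * n), Finset.prod_range_succ _ n,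
      prod_range_two_mul, prod_range_two_mul]
    simp only [il_even, il_odd]
    have h : (∏ k ∈ Finset.range n, ((a * x n - a * x k) * (a * x n - b * x k))) *
        (∏ k ∈ Finset.range n, ((b * x n - a * x k) * (b * x n - b * x k))) =
        (∏ k ∈ Finset.range n, (x n - x k)) * (∏ k ∈ Finset.range n, (x n ^ 3 - x k ^ 3)) := by
      rw [← Finset.prod_mul_distrib, ← Finset.prod_mul_distrib]
      apply Finset.prod_congr rfl
      intro k _
      generalize x n = y
      generalize x k = z
      have e1 : (a * y - a * z) * (b * y - b * z) = (y - z) ^ 2 := by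
        linear_combination (y - z) ^ 2 * hab
      have e2 : (a * y - b * z) * (b * y - a * z) = y ^ 2 + y * z + z ^ 2 := by
        linear_combination (y ^ 2 + z ^ 2) * hab - y * z * hab2
      calc _ = ((a * y - a * z) * (b * y - b * z)) * ((a * y - b * z) * (b * y - a * z)) := by ring
        _ = _ := by rw [e1, e2]; ring
    linear_combination ((∏ k ∈ Finset.range n, (b * x k - a * x k)) * VR n x *
      VR n (fun k => x k ^ 3) * (b * x n - a * x n)) * h

/-- index equivalence -/
def ieq (n : ℕ) : Fin 2 × Fin n ≃ Fin (2 * n) :=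
  (Equiv.prodComm _ _).trans (finProdFinEquiv.trans (finCongr (mul_comm n 2)))

theorem ieq_val (n : ℕ) (ε : Fin 2) (k : Fin n) : ((ieq n (ε, k) : Fin (2 * n)) : ℕ) = ε + 2 * k := by
  simp [ieq, finProdFinEquiv]

open scoped Kronecker in
theorem alt_il {A : Type*} [CommRing A] (a b : A) (ha : a ^ 3 = 1) (hb : b ^ 3 = 1)
    (x : ℕ → A) (n : ℕ) :
    alt (fun i : Fin (2 * n) => il a b x i) = (∏ k ∈ Finset.range n, (b * x k - a * x k)) *
      (VR n (fun k => x k ^ 3)) ^ 2 := by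
  unfold alt
  rw [← Matrix.det_submatrix_equiv_self (ieq n)]
  have hM : (Matrix.of fun i j : Fin (2 * n) => il a b x i ^ ex j).submatrix (ieq n) (ieq n) =
      Matrix.blockDiagonal (fun k : Fin n => Matrix.of fun ε δ : Fin 2 =>
        ((if ε = 0 then a else b) * x k) ^ (δ : ℕ)) *
      ((1 : Matrix (Fin 2) (Fin 2) A) ⊗ₖ Matrix.vandermonde (fun k : Fin n => x k ^ 3)) := by
    ext ⟨ε, k⟩ ⟨δ, m⟩
    have e1 : il a b x (ε + 2 * k) = (if ε = 0 then a else b) * x k := by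
      fin_cases ε
      · have := il_even a b x k
        simpa using this
      · have := il_odd a b x k
        simpa [add_comm] using this
    have e2 : ex (δ + 2 * m) = 3 * m + δ := by unfold ex; omega
    have e3 : ((if ε = 0 then a else b) * x k) ^ 3 = x k ^ 3 := by
      rw [mul_pow]; split_ifs <;> simp [ha, hb]
    rw [Matrix.submatrix_apply, Matrix.of_apply, ieq_val, ieq_val, e1, e2, pow_add, pow_mul, e3,
      Matrix.mul_apply, Fintype.sum_prod_type]
    simp only [Matrix.blockDiagonal_apply, Matrix.of_apply, Matrix.kroneckerMap_apply,
      Matrix.one_apply, Matrix.vandermonde_apply, ite_mul, zero_mul, one_mul, mul_ite, mul_zero]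
    rw [Finset.sum_comm, Finset.sum_eq_single k]
    · rw [Finset.sum_eq_single δ]
      · simp; ring_nf
      · intro c _ hc; simp [hc]
      · simp
    · intro c _ hc; simp [Ne.symm hc]
    · simp
  rw [hM, Matrix.det_mul, Matrix.det_blockDiagonal, Matrix.det_kronecker,
    vdm_VR n (fun k => x k ^ 3), Matrix.det_one, one_pow, one_mul, Fintype.card_fin]
  congr 1
  rw [← Fin.prod_univ_eq_prod_range (fun k => b * x k - a * x k)]
  apply Finset.prod_congr rfl
  intro k _
  rw [Matrix.det_fin_two]
  simp

theorem VR_cube {A : Type*} [CommRing A] (x : ℕ → A) (n : ℕ) :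
    VR n (fun k => x k ^ 3) = VR n x * ∏ j ∈ Finset.range n, ∏ i ∈ Finset.range j,
      (x j ^ 2 + x j * x i + x i ^ 2) := by
  unfold VR
  rw [← Finset.prod_mul_distrib]
  apply Finset.prod_congr rfl
  intro j _
  rw [← Finset.prod_mul_distrib]
  apply Finset.prod_congr rfl
  intro i _
  beta_reduce
  ring

theorem VR_X_ne (n c : ℕ) (hc : c ≠ 0) :
    VR n (fun k => ((Polynomial.X : Polynomial ℂ) ^ k) ^ c) ≠ 0 := by
  unfold VR
  refine Finset.prod_ne_zero_iff.2 fun j _ => Finset.prod_ne_zero_iff.2 fun i hi => ?_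
  have := Finset.mem_range.1 hi
  rw [sub_ne_zero]
  beta_reduce
  rw [← pow_mul, ← pow_mul]
  intro h
  have h2 := congrArg Polynomial.natDegree h
  rw [Polynomial.natDegree_X_pow, Polynomial.natDegree_X_pow] at h2
  exact this.ne' (Nat.eq_of_mul_eq_mul_right (Nat.pos_of_ne_zero hc) h2)

theorem ident2 {n : ℕ} {S : MvPolynomial (Fin (2 * n)) ℂ}
    (hS : alt (fun i => (X i : MvPolynomial (Fin (2 * n)) ℂ)) =
      (∏ t ∈ prs (2 * n), (X t.2 - X t.1)) * S) :
    eval (fun k : Fin (2 * n) => if (k : ℕ) % 2 = 0 then q⁻¹ else q) S =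
      ∏ j ∈ Finset.range n, (3 : ℂ) ^ j := by
  have hq0 := q_ne_zero
  have hq3 := q_cube
  have hqi := q_inv
  set a : Polynomial ℂ := Polynomial.C q⁻¹ with ha
  set b : Polynomial ℂ := Polynomial.C q with hb
  set x : ℕ → Polynomial ℂ := fun k => Polynomial.X ^ k with hx
  have hab : a * b = 1 := by rw [ha, hb, ← Polynomial.C_mul, inv_mul_cancel₀ hq0, Polynomial.C_1]
  have hab2 : a ^ 2 + b ^ 2 = -1 := by
    rw [ha, hb, ← Polynomial.C_pow, ← Polynomial.C_pow, ← Polynomial.C_add, hqi]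
    rw [show (q ^ 2) ^ 2 + q ^ 2 = -1 by linear_combination q * hq3 + q_quad]
    simp
  have ha3 : a ^ 3 = 1 := by
    rw [ha, ← Polynomial.C_pow, inv_pow, hq3, inv_one, Polynomial.C_1]
  have hb3 : b ^ 3 = 1 := by
    rw [hb, ← Polynomial.C_pow, hq3, Polynomial.C_1]
  have h := schur_hom hS (aeval (fun i : Fin (2 * n) => il a b x i)
    : MvPolynomial (Fin (2 * n)) ℂ →ₐ[ℂ] Polynomial ℂ).toRingHom
  simp only [AlgHom.toRingHom_eq_coe, RingHom.coe_coe, aeval_X] at h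
  rw [alt_il a b ha3 hb3, vdm_VR (2 * n) (il a b x), VR_il a b hab hab2] at h
  have n1 : ∏ k ∈ Finset.range n, (b * x k - a * x k) ≠ 0 := by
    refine Finset.prod_ne_zero_iff.2 fun k _ => ?_
    rw [← sub_mul]
    refine mul_ne_zero ?_ (pow_ne_zero _ Polynomial.X_ne_zero)
    rw [ha, hb, ← Polynomial.C_sub, Polynomial.C_ne_zero, hqi, sub_ne_zero]
    exact q_sq_ne_q.symm
  have n2 : VR n x ≠ 0 := by
    have := VR_X_ne n 1 one_ne_zero
    simpa [hx] using this
  have n3 : VR n (fun k => x k ^ 3) ≠ 0 := VR_X_ne n 3 (by norm_num)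
  have h2 : ((∏ k ∈ Finset.range n, (b * x k - a * x k)) * VR n x * VR n (fun k => x k ^ 3)) *
      (∏ j ∈ Finset.range n, ∏ i ∈ Finset.range j, (x j ^ 2 + x j * x i + x i ^ 2)) =
      ((∏ k ∈ Finset.range n, (b * x k - a * x k)) * VR n x * VR n (fun k => x k ^ 3)) *
      (aeval (fun i : Fin (2 * n) => il a b x i) S) := by
    rw [← h]
    have := VR_cube x n
    linear_combination (-(∏ k ∈ Finset.range n, (b * x k - a * x k)) *
      VR n (fun k => x k ^ 3)) * this
  have h3 := congrArg (Polynomial.eval 1) (mul_left_cancel₀ (mul_ne_zero (mul_ne_zero n1 n2) n3) h2)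
  rw [eval_one_aeval] at h3
  have e : (fun i : Fin (2 * n) => (il a b x i).eval 1) =
      fun k : Fin (2 * n) => if (k : ℕ) % 2 = 0 then q⁻¹ else q := by
    funext i
    unfold il
    split_ifs <;> simp [ha, hb, hx]
  rw [e] at h3
  rw [← h3, Polynomial.eval_prod]
  apply Finset.prod_congr rfl
  intro j _
  rw [Polynomial.eval_prod]
  simp only [hx, Polynomial.eval_add, Polynomial.eval_mul, Polynomial.eval_pow, Polynomial.eval_X,
    one_pow, Finset.prod_const, Finset.card_range]
  norm_num

theorem schur_nc {n : ℕ} {S : MvPolynomial (Fin (2 * n)) ℂ}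
    (hS : alt (fun i => (X i : MvPolynomial (Fin (2 * n)) ℂ)) =
      (∏ t ∈ prs (2 * n), (X t.2 - X t.1)) * S) (π : NCM n) :
    evalNC S π = ∏ j ∈ Finset.range n, (3 : ℂ) ^ j := by
  have hc : (Finset.univ.filter (fun k : Fin (2 * n) => (k : ℕ) % 2 = 0)).card = n := by
    have h1 : (Finset.univ.filter (fun k : Fin (2 * n) => (k : ℕ) % 2 = 0)) =
        (Finset.univ : Finset (Fin n)).image (fun k : Fin n => (⟨2 * (k : ℕ), by omega⟩ : Fin (2 * n))) := by
      ext k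
      simp only [Finset.mem_filter, Finset.mem_univ, true_and, Finset.mem_image]
      constructor
      · intro h
        exact ⟨⟨(k : ℕ) / 2, by omega⟩, Fin.ext (by simp; omega)⟩
      · rintro ⟨m, rfl⟩
        simp
    rw [h1, Finset.card_image_of_injective, Finset.card_univ, Fintype.card_fin]
    intro k m hkm
    have := congrArg Fin.val hkm
    simp only at this
    exact Fin.ext (by omega)
  obtain ⟨σ, hσ⟩ := exists_perm (fun k : Fin (2 * n) => (k : ℕ) % 2 = 0)
    (fun k : Fin (2 * n) => k < π.f k) (hc.trans (NCM.card_open π).symm)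
  rw [← ident2 hS, evalNC, ← schur_symm hS σ, eval_rename, schur_symm hS σ]
  congr 2
  funext k
  simp only [Function.comp, hσ]

end Ident

/-- The sum rule (Theorem 2.21): `Σ_{π ∈ NC_n} Ψ_π(1,…,1) = ASM(n)`. -/
theorem sum_rule (n : ℕ) (hn : 1 ≤ n)
    (Ψ : NCM n → MvPolynomial (Fin (2 * n)) ℂ)
    (hwheel : ∀ π, IsWheel n (Ψ π))
    (hdual : ∀ π σ : NCM n, evalNC (Ψ π) σ = if σ = π then 1 else 0) :
    ∑ π : NCM n, evalOne (Ψ π) = ASM n := by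
  obtain ⟨S, hS, hdeg⟩ := schur_exists n
  have hc0 : (∏ j ∈ Finset.range n, (3 : ℂ) ^ j) ≠ 0 :=
    Finset.prod_ne_zero_iff.2 fun j _ => pow_ne_zero _ (by norm_num)
  set c : ℂ := ∏ j ∈ Finset.range n, (3 : ℂ) ^ j with hc
  have hD : (∑ π : NCM n, Ψ π) - C c⁻¹ * S = 0 := by
    apply uniq n Finset.univ (by simp)
    · refine (totalDegree_sub _ _).trans (max_le ?_ ?_)
      · exact totalDegree_finsetSum_le fun π _ => (hwheel π).1.totalDegree_le
      · refine (totalDegree_mul _ _).trans ?_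
        rw [totalDegree_C, zero_add]
        exact hdeg
    · intro i hi j hj k hk hij hjk z h1 h2
      rw [map_sub, map_sum, map_mul, schur_wheel hS i hi j hj k hk hij hjk z h1 h2, mul_zero,
        sub_zero]
      exact Finset.sum_eq_zero fun π _ => (hwheel π).wh i hi j hj k hk hij hjk z h1 h2
    · intro z hz
      obtain ⟨σ, rfl⟩ := hz.ncm
      rw [map_sub, map_sum, map_mul, eval_C]
      have h1 : ∀ π, eval (fun k => if k < σ.f k then q⁻¹ else q) (Ψ π) = evalNC (Ψ π) σ :=
        fun _ => rfl
      have h2 : eval (fun k => if k < σ.f k then q⁻¹ else q) S = evalNC S σ := rfl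
      rw [h2, schur_nc hS σ, ← hc, inv_mul_cancel₀ hc0]
      simp only [h1, hdual]
      simp
  have h1 := congrArg (eval (fun _ => (1 : ℂ))) hD
  rw [map_sub, map_sum, map_mul, eval_C, map_zero, sub_eq_zero] at h1
  have h2 := ident1 hS
  rw [ident3, ← hc, mul_comm] at h2
  have h3 := mul_left_cancel₀ (VR_id_ne (2 * n)) h2
  change ∑ π : NCM n, evalOne (Ψ π) = c⁻¹ * evalOne S at h1
  rw [h1, ← h3, inv_mul_cancel_left₀ hc0]
end
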